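/- arXiv:1511.05767 — 4 statements merged into one kernel-verified Lean document; each statement's English description precedes it below -/
import Mathlib

section
/- Let n ≥ 3. There exists a maximal subgroup M of SL(n,ℤ) of infinite index such that the natural transitive action of SL(n,ℤ) on the coset space SL(n,ℤ)/M is primitive but not 2-transitive: there exist two pairs of distinct cosets (x₁,y₁) and (x₂,y₂) such that no g ∈ SL(n,ℤ) satisfies g•x₁ = x₂ and g•y₁ = y₂. -/
/- Common setup: `SL(n,ℤ)`, `SL(n,ℝ)`, the real projective space `ℙ^{n-1}(ℝ)`
with its quotient topology and the projective action, rank-1 unipotent elements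
and their attracting points / fixed hyperplanes, metrics compatible with the
topology of `ℙ`, `ε`-neighbourhoods, Schottky systems, profinite density,
maximal subgroups, and lattices in `SL(n,ℝ)`. -/

open Matrix LinearAlgebra.Projectivization

abbrev SLZ (n : ℕ) := Matrix.SpecialLinearGroup (Fin n) ℤ

abbrev SLR (n : ℕ) := Matrix.SpecialLinearGroup (Fin n) ℝ

/-- The real projective space `ℙ^{n-1}(ℝ)`: the projectivization of `ℝⁿ`. -/
abbrev Proj (n : ℕ) := Projectivization ℝ (Fin n → ℝ)

/-- The quotient topology on `ℙ^{n-1}(ℝ)`. -/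
noncomputable instance (n : ℕ) : TopologicalSpace (Proj n) :=
  inferInstanceAs (TopologicalSpace (Quotient _))

/-- The action of `SL(n,ℝ)` on `ℙ^{n-1}(ℝ)` induced by the linear action on `ℝⁿ`. -/
noncomputable def actR {n : ℕ} (g : SLR n) (x : Proj n) : Proj n :=
  Projectivization.map (Matrix.SpecialLinearGroup.toLin' g).toLinearMap
    (Matrix.SpecialLinearGroup.toLin' g).injective x

/-- The action of `SL(n,ℤ)` on `ℙ^{n-1}(ℝ)` induced by the linear action on `ℝⁿ`. -/
noncomputable def act {n : ℕ} (g : SLZ n) (x : Proj n) : Proj n :=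
  actR (Matrix.SpecialLinearGroup.map (Int.castRingHom ℝ) g) x

/-- The real matrix attached to `g ∈ SL(n,ℤ)`. -/
noncomputable def matR {n : ℕ} (g : SLZ n) : Matrix (Fin n) (Fin n) ℝ :=
  ((Matrix.SpecialLinearGroup.map (Int.castRingHom ℝ)) g : Matrix (Fin n) (Fin n) ℝ)

/-- The subspace `Im(u - I) ⊆ ℝⁿ` (a line when `u` is rank-1 unipotent). -/
noncomputable def lineOf {n : ℕ} (u : SLZ n) : Submodule ℝ (Fin n → ℝ) :=
  LinearMap.range (Matrix.mulVecLin (matR u - 1))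

/-- The subspace `ker(u - I) ⊆ ℝⁿ` (a hyperplane when `u` is rank-1 unipotent). -/
noncomputable def hypOf {n : ℕ} (u : SLZ n) : Submodule ℝ (Fin n → ℝ) :=
  LinearMap.ker (Matrix.mulVecLin (matR u - 1))

/-- The rational matrix attached to `g ∈ SL(n,ℤ)`. -/
noncomputable def matQ {n : ℕ} (g : SLZ n) : Matrix (Fin n) (Fin n) ℚ :=
  ((Matrix.SpecialLinearGroup.map (Int.castRingHom ℚ)) g : Matrix (Fin n) (Fin n) ℚ)

/-- `g - I`, as a `ℚ`-linear endomorphism of `ℚⁿ`. -/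
noncomputable def linQ {n : ℕ} (g : SLZ n) : (Fin n → ℚ) →ₗ[ℚ] (Fin n → ℚ) :=
  Matrix.mulVecLin (matQ g - 1)

/-- `u` is a rank-1 unipotent element of `SL(n,ℤ)`: `u - I` is nilpotent of rank one. -/
def IsR1U {n : ℕ} (u : SLZ n) : Prop :=
  IsNilpotent (linQ u) ∧ Module.finrank ℚ (LinearMap.range (linQ u)) = 1

/-- The point of attraction `p_u` of `u`, as a subset of `ℙ` (a singleton when `u` is a
rank-1 unipotent): the projective points whose representative spans `Im(u - I)`. -/
def attSet {n : ℕ} (u : SLZ n) : Set (Proj n) :=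
  {x | x.submodule = lineOf u}

/-- The fixed hyperplane `L_u` of `u`, as a subset of `ℙ`. -/
def fixSet {n : ℕ} (u : SLZ n) : Set (Proj n) :=
  {x | x.submodule ≤ hypOf u}

/-- The subset of `ℙ` corresponding to a linear subspace `W ⊆ ℝⁿ`. -/
def projSet {n : ℕ} (W : Submodule ℝ (Fin n → ℝ)) : Set (Proj n) :=
  {x | x.submodule ≤ W}

/-- The image `g • W` of a subspace of `ℝⁿ` under `g ∈ SL(n,ℤ)`. -/
noncomputable def actSub {n : ℕ} (g : SLZ n) (W : Submodule ℝ (Fin n → ℝ)) :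
    Submodule ℝ (Fin n → ℝ) :=
  Submodule.map (Matrix.mulVecLin (matR g)) W

/-- The image `g • W` of a subspace of `ℝⁿ` under `g ∈ SL(n,ℝ)`. -/
noncomputable def actSubR {n : ℕ} (g : SLR n) (W : Submodule ℝ (Fin n → ℝ)) :
    Submodule ℝ (Fin n → ℝ) :=
  Submodule.map (Matrix.mulVecLin (g : Matrix (Fin n) (Fin n) ℝ)) W

/-- `d` is a metric on `ℙ^{n-1}(ℝ)` inducing the quotient topology. -/
structure IsCompatMetric {n : ℕ} (d : Proj n → Proj n → ℝ) : Prop where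
  self : ∀ x, d x x = 0
  eq_of : ∀ x y, d x y = 0 → x = y
  symm : ∀ x y, d x y = d y x
  triangle : ∀ x y z, d x z ≤ d x y + d y z
  inducing : ∀ s : Set (Proj n), IsOpen s ↔ ∀ x ∈ s, ∃ ε > 0, ∀ y, d x y < ε → y ∈ s

/-- The distance from a point to a set. -/
noncomputable def setDist {n : ℕ} (d : Proj n → Proj n → ℝ) (x : Proj n)
    (A : Set (Proj n)) : ℝ :=
  sInf (d x '' A)

/-- The open `ε`-neighbourhood `(A)_ε = {x | dist(x, A) < ε}`. -/
def oThick {n : ℕ} (d : Proj n → Proj n → ℝ) (A : Set (Proj n)) (ε : ℝ) : Set (Proj n) :=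
  {x | setDist d x A < ε}

/-- The closed `ε`-neighbourhood `[A]_ε = {x | dist(x, A) ≤ ε}`. -/
def cThick {n : ℕ} (d : Proj n → Proj n → ℝ) (A : Set (Proj n)) (ε : ℝ) : Set (Proj n) :=
  {x | setDist d x A ≤ ε}

/-- The Hausdorff distance between two subsets of `ℙ`. -/
noncomputable def hDist {n : ℕ} (d : Proj n → Proj n → ℝ) (A B : Set (Proj n)) : ℝ :=
  max (sSup ((fun a => setDist d a B) '' A)) (sSup ((fun b => setDist d b A) '' B))

/-- A rational point of `ℙ`: one spanned by a vector of `ℚⁿ`. -/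
def RatPoint {n : ℕ} (p : Proj n) : Prop :=
  ∃ v : Fin n → ℚ, p.submodule = Submodule.span ℝ {fun i => ((v i : ℝ))}

/-- A subspace of `ℝⁿ` spanned by vectors of `ℚⁿ`. -/
def IsRatSubmodule {n : ℕ} (W : Submodule ℝ (Fin n → ℝ)) : Prop :=
  ∃ T : Set (Fin n → ℚ),
    W = Submodule.span ℝ ((fun (v : Fin n → ℚ) (i : Fin n) => ((v i : ℝ))) '' T)

/-- A Schottky system `(S, 𝒜, ℛ)` with respect to the metric `d`: `S` is a nonempty
set of rank-1 unipotents, `𝒜 ⊆ ℛ` are closed, and for each `u ∈ S` there are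
`δ_u ≥ ε_u > 0` satisfying the ping-pong conditions. -/
structure IsSchottky {n : ℕ} (d : Proj n → Proj n → ℝ) (S : Set (SLZ n))
    (A R : Set (Proj n)) : Prop where
  nonempty : S.Nonempty
  unip : ∀ u ∈ S, IsR1U u
  AsubR : A ⊆ R
  closedA : IsClosed A
  closedR : IsClosed R
  cond : ∃ ε δ : SLZ n → ℝ, (∀ u ∈ S, 0 < ε u ∧ ε u ≤ δ u) ∧
    (∀ u ∈ S, ∀ k : ℤ, k ≠ 0 → ∀ x, x ∉ oThick d (fixSet u) (δ u) →
      act (u ^ k) x ∈ oThick d (attSet u) (ε u)) ∧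
    (∀ u ∈ S, ∀ v ∈ S, u ≠ v → oThick d (attSet u) (ε u) ∩ oThick d (fixSet v) (δ v) = ∅) ∧
    (∀ u ∈ S, oThick d (attSet u) (ε u) ⊆ A) ∧
    (∀ u ∈ S, oThick d (fixSet u) (δ u) ⊆ R)

/-- `H` is profinitely dense in `G`: `HN = G` for every finite-index normal `N ⊴ G`. -/
def ProfinitelyDense {G : Type*} [Group G] (H : Subgroup G) : Prop :=
  ∀ N : Subgroup G, N.Normal → N.FiniteIndex → H ⊔ N = ⊤

/-- `M` is a maximal (proper) subgroup of `G`. -/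
def IsMaxSubgroup {G : Type*} [Group G] (M : Subgroup G) : Prop :=
  M ≠ ⊤ ∧ ∀ K : Subgroup G, M < K → K = ⊤

noncomputable instance (n : ℕ) : TopologicalSpace (SLR n) :=
  inferInstanceAs (TopologicalSpace {A : Matrix (Fin n) (Fin n) ℝ // A.det = 1})

noncomputable instance (n : ℕ) : MeasurableSpace (SLR n) := borel _

/-- `Γ ≤ SL(n,ℝ)` is a lattice: a discrete subgroup admitting a Borel fundamental
domain of finite Haar measure. -/
def IsLatticeIn {n : ℕ} (Γ : Subgroup (SLR n)) : Prop :=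
  DiscreteTopology Γ ∧
  ∃ μ : MeasureTheory.Measure (SLR n), μ.IsHaarMeasure ∧
    ∃ D : Set (SLR n), MeasurableSet D ∧ μ D < ⊤ ∧
      ∀ g : SLR n, ∃! γ : Γ, (γ : SLR n)⁻¹ * g ∈ D

section Transvections

variable {n : ℕ}

/-- The transvection `x ↦ x + (f ⬝ᵥ x) • v` when `f ⬝ᵥ v = 0`, and the identity otherwise. -/
def tv (v f : Fin n → ℤ) : SLZ n :=
  if h : f ⬝ᵥ v = 0 then
    ⟨1 + vecMulVec v f, by
      rw [vecMulVec_eq Unit, det_one_add_replicateCol_mul_replicateRow, h, add_zero]⟩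
  else 1

theorem coe_tv {v f : Fin n → ℤ} (h : f ⬝ᵥ v = 0) :
    (tv v f : Matrix (Fin n) (Fin n) ℤ) = 1 + vecMulVec v f := by
  simp [tv, h]

/-- The action of `SL(n,ℤ)` on column vectors. -/
def mv (g : SLZ n) (x : Fin n → ℤ) : Fin n → ℤ := g.1 *ᵥ x

/-- The action of `SL(n,ℤ)` on row vectors. -/
def cv (f : Fin n → ℤ) (g : SLZ n) : Fin n → ℤ := f ᵥ* g.1

@[simp] theorem mv_one (x : Fin n → ℤ) : mv 1 x = x := one_mulVec x

theorem mv_mul (g h : SLZ n) (x : Fin n → ℤ) : mv (g * h) x = mv g (mv h x) :=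
  (mulVec_mulVec x g.1 h.1).symm

theorem mv_add (g : SLZ n) (x y : Fin n → ℤ) : mv g (x + y) = mv g x + mv g y :=
  mulVec_add _ _ _

theorem mv_smul (g : SLZ n) (c : ℤ) (x : Fin n → ℤ) : mv g (c • x) = c • mv g x :=
  mulVec_smul _ _ _

theorem mv_zero (g : SLZ n) : mv g 0 = 0 := mulVec_zero _

theorem dotProduct_mv (f : Fin n → ℤ) (g : SLZ n) (x : Fin n → ℤ) :
    f ⬝ᵥ mv g x = cv f g ⬝ᵥ x :=
  dotProduct_mulVec _ _ _

theorem mv_single (g : SLZ n) (i k : Fin n) : mv g (Pi.single i 1) k = g.1 k i := by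
  simp [mv]

theorem mv_inv_mv (g : SLZ n) (x : Fin n → ℤ) : mv g⁻¹ (mv g x) = x := by
  rw [← mv_mul, inv_mul_cancel, mv_one]

theorem mv_mv_inv (g : SLZ n) (x : Fin n → ℤ) : mv g (mv g⁻¹ x) = x := by
  rw [← mv_mul, mul_inv_cancel, mv_one]

theorem mv_ext {g g' : SLZ n} (h : ∀ x, mv g x = mv g' x) : g = g' :=
  Subtype.ext (Matrix.mulVec_injective (funext h))

theorem mv_tv {v f : Fin n → ℤ} (h : f ⬝ᵥ v = 0) (x : Fin n → ℤ) :
    mv (tv v f) x = x + (f ⬝ᵥ x) • v := by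
  rw [mv, coe_tv h, add_mulVec, one_mulVec, vecMulVec_mulVec]
  simp

theorem cv_tv {v f : Fin n → ℤ} (h : f ⬝ᵥ v = 0) (φ : Fin n → ℤ) :
    cv φ (tv v f) = φ + (φ ⬝ᵥ v) • f := by
  rw [cv, coe_tv h, vecMul_add, vecMul_one, vecMul_vecMulVec]

theorem smul_dotProduct_zero {v f : Fin n → ℤ} (h : f ⬝ᵥ v = 0) (k : ℤ) : (k • f) ⬝ᵥ v = 0 := by
  rw [smul_dotProduct, h, smul_zero]

theorem neg_dotProduct_zero {v f : Fin n → ℤ} (h : f ⬝ᵥ v = 0) : (-f) ⬝ᵥ v = 0 := by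
  rw [neg_dotProduct, h, neg_zero]

theorem tv_mul_tv {v f f' : Fin n → ℤ} (h : f ⬝ᵥ v = 0) (h' : f' ⬝ᵥ v = 0) :
    tv v f * tv v f' = tv v (f + f') := by
  refine mv_ext fun x => ?_
  have h2 : (f + f') ⬝ᵥ v = 0 := by rw [add_dotProduct, h, h', add_zero]
  rw [mv_mul, mv_tv h', mv_tv h, mv_tv h2, dotProduct_add, dotProduct_smul, h, add_dotProduct]
  module

theorem tv_zero (v : Fin n → ℤ) : tv v 0 = 1 := by
  refine mv_ext fun x => ?_
  rw [mv_tv (by simp)]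
  simp

theorem tv_inv {v f : Fin n → ℤ} (h : f ⬝ᵥ v = 0) : (tv v f)⁻¹ = tv v (-f) := by
  rw [inv_eq_iff_mul_eq_one, tv_mul_tv h (neg_dotProduct_zero h), add_neg_cancel, tv_zero]

theorem tv_pow {v f : Fin n → ℤ} (h : f ⬝ᵥ v = 0) (k : ℕ) :
    tv v f ^ k = tv v ((k : ℤ) • f) := by
  induction k with
  | zero => simp [tv_zero]
  | succ k ih =>
    rw [pow_succ, ih, tv_mul_tv (smul_dotProduct_zero h _) h]
    congr 1
    push_cast
    module

theorem tv_zpow {v f : Fin n → ℤ} (h : f ⬝ᵥ v = 0) (k : ℤ) : tv v f ^ k = tv v (k • f) := by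
  obtain ⟨m, rfl | rfl⟩ := k.eq_nat_or_neg
  · rw [zpow_natCast, tv_pow h]
  · rw [_root_.zpow_neg, zpow_natCast, tv_pow h, tv_inv (smul_dotProduct_zero h _), neg_smul]

theorem tv_smul_left {v f : Fin n → ℤ} (h : f ⬝ᵥ v = 0) (c : ℤ) :
    tv (c • v) f = tv v (c • f) := by
  have h1 : f ⬝ᵥ (c • v) = 0 := by rw [dotProduct_smul, h, smul_zero]
  refine mv_ext fun x => ?_
  rw [mv_tv h1, mv_tv (smul_dotProduct_zero h c), smul_dotProduct]
  module

theorem tv_conj_dotProduct {v f : Fin n → ℤ} (h : f ⬝ᵥ v = 0) (g : SLZ n) :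
    cv f g⁻¹ ⬝ᵥ mv g v = 0 := by
  rw [← dotProduct_mv, mv_inv_mv, h]

theorem tv_conj {v f : Fin n → ℤ} (h : f ⬝ᵥ v = 0) (g : SLZ n) :
    g * tv v f * g⁻¹ = tv (mv g v) (cv f g⁻¹) := by
  rw [mul_inv_eq_iff_eq_mul]
  refine mv_ext fun x => ?_
  rw [mv_mul, mv_mul, mv_tv h, mv_tv (tv_conj_dotProduct h g), mv_add, mv_smul, ← dotProduct_mv,
    mv_inv_mv]

theorem tv_conj_tv {v f a φ : Fin n → ℤ} (h : f ⬝ᵥ v = 0) (h' : φ ⬝ᵥ a = 0) :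
    tv v f * tv a φ * (tv v f)⁻¹ = tv (a + (f ⬝ᵥ a) • v) (φ - (φ ⬝ᵥ v) • f) := by
  rw [tv_conj h', mv_tv h, tv_inv h, cv_tv (neg_dotProduct_zero h), smul_neg, sub_eq_add_neg]

/-- A covector with both a positive and a negative entry. -/
def Indefinite (f : Fin n → ℤ) : Prop := ∃ i j, 0 < f i ∧ f j < 0

/-- The `ℓ¹`-norm of an integer vector. -/
def nrm (x : Fin n → ℤ) : ℤ := ∑ i, |x i|

theorem nrm_nonneg (x : Fin n → ℤ) : 0 ≤ nrm x := Finset.sum_nonneg fun _ _ => abs_nonneg _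

theorem abs_le_nrm (x : Fin n → ℤ) (i : Fin n) : |x i| ≤ nrm x :=
  Finset.single_le_sum (f := fun i => |x i|) (fun _ _ => abs_nonneg _) (Finset.mem_univ i)

theorem nrm_add_le (x y : Fin n → ℤ) : nrm (x + y) ≤ nrm x + nrm y := by
  unfold nrm
  rw [← Finset.sum_add_distrib]
  exact Finset.sum_le_sum fun i _ => abs_add_le _ _

theorem nrm_smul (c : ℤ) (x : Fin n → ℤ) : nrm (c • x) = |c| * nrm x := by
  simp [nrm, Finset.mul_sum, abs_mul]

theorem abs_dotProduct_le (f x : Fin n → ℤ) : |f ⬝ᵥ x| ≤ nrm f * nrm x := by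
  calc |f ⬝ᵥ x| ≤ ∑ i, |f i * x i| := Finset.abs_sum_le_sum_abs _ _
    _ ≤ ∑ i, nrm f * |x i| := Finset.sum_le_sum fun i _ => by
        rw [abs_mul]
        exact mul_le_mul_of_nonneg_right (abs_le_nrm f i) (abs_nonneg _)
    _ = nrm f * nrm x := by rw [nrm, nrm, Finset.mul_sum]

end Transvections

section PingPong

variable {n : ℕ}

/-- The data `(w, g)` of a transvection `1 + w ⊗ g` whose fixed hyperplane misses the positive
orthant and whose entries are all large. -/
structure GoodPair (p : (Fin n → ℤ) × (Fin n → ℤ)) : Prop where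
  dot : p.2 ⬝ᵥ p.1 = 0
  pos : ∀ k, 2 ≤ p.2 k
  abs : ∀ k, 2 ≤ |p.1 k|

/-- The attracting region of `q` avoids the repelling region of `p`. -/
def Compat (p q : (Fin n → ℤ) × (Fin n → ℤ)) : Prop :=
  nrm q.1 + nrm p.2 + 1 ≤ |p.2 ⬝ᵥ q.1|

/-- A set of pairs generating a group that plays ping-pong. -/
structure Admissible (S : Set ((Fin n → ℤ) × (Fin n → ℤ))) : Prop where
  good : ∀ p ∈ S, GoodPair p
  compat : S.Pairwise Compat

/-- The group generated by the transvections attached to a set of pairs. -/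
def tvGroup (S : Set ((Fin n → ℤ) × (Fin n → ℤ))) : Subgroup (SLZ n) :=
  Subgroup.closure ((fun p => tv p.1 p.2) '' S)

theorem tv_mem_tvGroup {S : Set ((Fin n → ℤ) × (Fin n → ℤ))} {p} (hp : p ∈ S) :
    tv p.1 p.2 ∈ tvGroup S :=
  Subgroup.subset_closure ⟨p, hp, rfl⟩

/-- The attracting region of a pair. -/
def Attr (p : (Fin n → ℤ) × (Fin n → ℤ)) : Set (Fin n → ℤ) :=
  {x | ∃ c : ℤ, c ≠ 0 ∧ nrm (x - c • p.1) ≤ |c|}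

/-- Elements with a reduced expression in the generators, with the leading letter recorded. -/
inductive Reduced (S : Set ((Fin n → ℤ) × (Fin n → ℤ))) :
    Option ((Fin n → ℤ) × (Fin n → ℤ)) → SLZ n → Prop
  | one : Reduced S none 1
  | cons (p : (Fin n → ℤ) × (Fin n → ℤ)) (o : Option ((Fin n → ℤ) × (Fin n → ℤ))) (k : ℤ)
      (g : SLZ n) : p ∈ S → k ≠ 0 → o ≠ some p → Reduced S o g →
      Reduced S (some p) (tv p.1 p.2 ^ k * g)

theorem Reduced.zpow_mul {S : Set ((Fin n → ℤ) × (Fin n → ℤ))} {o g} (h : Reduced S o g) {p}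
    (hp : p ∈ S) (k : ℤ) : ∃ o', Reduced S o' (tv p.1 p.2 ^ k * g) := by
  by_cases hk : k = 0
  · exact ⟨o, by simpa [hk] using h⟩
  by_cases ho : o = some p
  · subst ho
    cases h with
    | cons _ o k' g hp' hk' ho' hg =>
      rw [← mul_assoc, ← _root_.zpow_add]
      by_cases hkk : k + k' = 0
      · exact ⟨o, by simpa [hkk] using hg⟩
      · exact ⟨_, Reduced.cons p o _ g hp hkk ho' hg⟩
  · exact ⟨_, Reduced.cons p o k g hp hk ho h⟩

theorem exists_reduced {S : Set ((Fin n → ℤ) × (Fin n → ℤ))} {g : SLZ n} (hg : g ∈ tvGroup S) :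
    ∃ o, Reduced S o g := by
  induction hg using Subgroup.closure_induction_left with
  | one => exact ⟨none, Reduced.one⟩
  | mul_left x hx y _ ih =>
    obtain ⟨p, hp, rfl⟩ := hx
    obtain ⟨o, ho⟩ := ih
    simpa using ho.zpow_mul hp 1
  | inv_mul_cancel x hx y _ ih =>
    obtain ⟨p, hp, rfl⟩ := hx
    obtain ⟨o, ho⟩ := ih
    simpa using ho.zpow_mul hp (-1)

theorem zpow_mulVec_mem_Attr {p : (Fin n → ℤ) × (Fin n → ℤ)} (hp : GoodPair p) {k : ℤ}
    (hk : k ≠ 0) {x : Fin n → ℤ} (hx : 0 < |p.2 ⬝ᵥ x|) (hx' : nrm x ≤ |p.2 ⬝ᵥ x|) :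
    mv (tv p.1 p.2 ^ k) x ∈ Attr p := by
  refine ⟨k * (p.2 ⬝ᵥ x), mul_ne_zero hk (abs_pos.mp hx), ?_⟩
  rw [tv_zpow hp.dot, mv_tv (smul_dotProduct_zero hp.dot k), smul_dotProduct, smul_eq_mul,
    add_sub_cancel_right, abs_mul]
  nlinarith [Int.one_le_abs hk]

theorem le_abs_dotProduct_of_mem_Attr {p q : (Fin n → ℤ) × (Fin n → ℤ)} (h : Compat p q)
    {x : Fin n → ℤ} (hx : x ∈ Attr q) : 0 < |p.2 ⬝ᵥ x| ∧ nrm x ≤ |p.2 ⬝ᵥ x| := by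
  obtain ⟨c, hc, hcx⟩ := hx
  obtain ⟨y, rfl⟩ : ∃ y, x = c • q.1 + y := ⟨x - c • q.1, by abel⟩
  rw [add_sub_cancel_left] at hcx
  have h1 : nrm (c • q.1 + y) ≤ |c| * nrm q.1 + |c| :=
    (nrm_add_le _ _).trans (by rw [nrm_smul]; linarith)
  have h2 : |p.2 ⬝ᵥ y| ≤ nrm p.2 * |c| :=
    (abs_dotProduct_le _ _).trans (mul_le_mul_of_nonneg_left hcx (nrm_nonneg _))
  have h3 : |c| * |p.2 ⬝ᵥ q.1| - |p.2 ⬝ᵥ y| ≤ |p.2 ⬝ᵥ (c • q.1 + y)| := by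
    rw [dotProduct_add, dotProduct_smul, smul_eq_mul, ← abs_mul]
    have := abs_sub_abs_le_abs_sub (c * p.2 ⬝ᵥ q.1) (-(p.2 ⬝ᵥ y))
    rwa [abs_neg, sub_neg_eq_add] at this
  have h4 := mul_le_mul_of_nonneg_left h (abs_nonneg c)
  have h5 := Int.one_le_abs hc
  have h6 := nrm_nonneg q.1
  constructor <;> nlinarith

theorem Reduced.mulVec_mem {S : Set ((Fin n → ℤ) × (Fin n → ℤ))} (hS : Admissible S)
    (i : Fin n) {o g} (h : Reduced S o g) :
    (o = none ∧ g = 1) ∨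
      ∃ p ∈ S, o = some p ∧ mv g (Pi.single i 1) ∈ Attr p := by
  induction h with
  | one => exact Or.inl ⟨rfl, rfl⟩
  | cons p o k g hp hk ho hg ih =>
    refine Or.inr ⟨p, hp, rfl, ?_⟩
    rw [mv_mul]
    obtain ⟨rfl, rfl⟩ | ⟨q, hq, rfl, hx⟩ := ih
    · have h1 : nrm (Pi.single i 1 : Fin n → ℤ) = 1 := by
        rw [nrm, Finset.sum_eq_single i] <;> simp +contextual
      have h2 := (hS.good p hp).pos i
      have h3 : |p.2 i| = p.2 i := abs_of_nonneg (by linarith)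
      refine zpow_mulVec_mem_Attr (hS.good p hp) hk ?_ ?_ <;>
        simp only [mv_one, dotProduct_single, mul_one] <;> linarith
    · have hqp : p ≠ q := fun h => ho (by rw [h])
      have := le_abs_dotProduct_of_mem_Attr (hS.compat hp hq hqp) hx
      exact zpow_mulVec_mem_Attr (hS.good p hp) hk this.1 this.2

theorem exists_neg_of_mem_Attr {p : (Fin n → ℤ) × (Fin n → ℤ)} (hp : GoodPair p) (i : Fin n)
    {x : Fin n → ℤ} (hx : x ∈ Attr p) : ∃ k, x k < 0 := by
  obtain ⟨c, hc, hcx⟩ := hx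
  obtain ⟨k, hk⟩ : ∃ k, c * p.1 k < 0 := by
    by_contra! hall
    have h0 : ∑ k, p.2 k * (c * p.1 k) = 0 := by
      have : c * (p.2 ⬝ᵥ p.1) = 0 := by rw [hp.dot, mul_zero]
      rw [← this, dotProduct, Finset.mul_sum]
      exact Finset.sum_congr rfl fun _ _ => by ring
    have h1 := (Finset.sum_eq_zero_iff_of_nonneg (fun k _ =>
      mul_nonneg (by linarith [hp.pos k]) (hall k))).mp h0 i (Finset.mem_univ i)
    have h2 := hp.pos i
    have h3 := hp.abs i
    rcases mul_eq_zero.mp h1 with h | h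
    · omega
    · rcases mul_eq_zero.mp h with h | h
      · exact hc h
      · rw [h, abs_zero] at h3; omega
  refine ⟨k, ?_⟩
  have h1 := (abs_le_nrm _ k).trans hcx
  have h2 : |c * p.1 k| = |c| * |p.1 k| := abs_mul _ _
  rw [abs_of_neg hk] at h2
  have h3 := hp.abs k
  have h4 := Int.one_le_abs hc
  have h5 := (abs_le.mp h1).2
  simp only [Pi.sub_apply, Pi.smul_apply, smul_eq_mul] at h5
  nlinarith

/-- An element moving a basis vector to another nonnegative vector is not in the group. -/
theorem notMem_tvGroup {S : Set ((Fin n → ℤ) × (Fin n → ℤ))} (hS : Admissible S)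
    {g : SLZ n} (i : Fin n) (hg : ∀ k, 0 ≤ mv g (Pi.single i 1) k)
    (hg1 : g ≠ 1) : g ∉ tvGroup S := by
  intro hmem
  obtain ⟨o, ho⟩ := exists_reduced hmem
  obtain ⟨-, h⟩ | ⟨p, hp, -, hx⟩ := ho.mulVec_mem hS i
  · exact hg1 h
  · obtain ⟨k, hk⟩ := exists_neg_of_mem_Attr (hS.good p hp) i hx
    exact absurd (hg k) (by linarith)

end PingPong

section Generation

variable {n : ℕ}

theorem tv_add_left {v v' f : Fin n → ℤ} (h : f ⬝ᵥ v = 0) (h' : f ⬝ᵥ v' = 0) :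
    tv (v + v') f = tv v f * tv v' f := by
  have h2 : f ⬝ᵥ (v + v') = 0 := by rw [dotProduct_add, h, h', add_zero]
  refine mv_ext fun x => ?_
  rw [mv_mul, mv_tv h', mv_tv h, mv_tv h2, dotProduct_add, dotProduct_smul, h']
  module

theorem tv_zero_left (f : Fin n → ℤ) : tv 0 f = 1 := by
  refine mv_ext fun x => ?_
  rw [mv_tv (dotProduct_zero f)]
  simp

theorem mv_tv_single {v : Fin n → ℤ} {j : Fin n} (h : v j = 0) (x : Fin n → ℤ) :
    mv (tv v (Pi.single j 1)) x = x + x j • v := by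
  rw [mv_tv (by simpa using h)]
  simp

theorem tv_single_mem {K : Subgroup (SLZ n)}
    (hK : ∀ i j, i ≠ j → tv (Pi.single i 1) (Pi.single j 1) ∈ K) {v : Fin n → ℤ} {j : Fin n}
    (h : v j = 0) : tv v (Pi.single j 1) ∈ K := by
  have key : ∀ s : Finset (Fin n),
      tv (∑ i ∈ s, Pi.single i (v i)) (Pi.single j 1) ∈ K ∧
        (∑ i ∈ s, Pi.single i (v i) : Fin n → ℤ) j = 0 := by
    intro s
    induction s using Finset.induction_on with
    | empty => simp [tv_zero_left, K.one_mem]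
    | insert a s ha ih =>
      rw [Finset.sum_insert ha]
      have h1 : (Pi.single a (v a) : Fin n → ℤ) j = 0 := by
        by_cases haj : j = a
        · subst haj; simpa using h
        · simp [haj]
      refine ⟨?_, by rw [Pi.add_apply, h1, ih.2, add_zero]⟩
      rw [tv_add_left ((single_one_dotProduct j _).trans h1)
        ((single_one_dotProduct j _).trans ih.2)]
      refine K.mul_mem ?_ ih.1
      by_cases haj : a = j
      · subst haj; rw [h]; simp [tv_zero_left, K.one_mem]
      · have h2 : (Pi.single j 1 : Fin n → ℤ) ⬝ᵥ Pi.single a 1 = 0 := by simp [haj]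
        have h3 : (Pi.single a (v a) : Fin n → ℤ) = v a • Pi.single a 1 := by
          rw [← Pi.single_smul, smul_eq_mul, mul_one]
        rw [h3, tv_smul_left h2, ← tv_zpow h2]
        exact K.zpow_mem (hK a j haj) _
  have := (key Finset.univ).1
  rwa [Finset.univ_sum_single] at this

/-- Euclidean algorithm on the entries outside `S`. -/
theorem exists_mv_eq_zero {K : Subgroup (SLZ n)}
    (hK : ∀ i j, i ≠ j → tv (Pi.single i 1) (Pi.single j 1) ∈ K) (S : Finset (Fin n))
    {k : Fin n} (hk : k ∉ S) (N : ℕ) : ∀ u : Fin n → ℤ, ∑ i ∈ Sᶜ, (u i).natAbs ≤ N →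
      ∃ h ∈ K, (∀ p ∈ S, mv h (Pi.single p 1) = Pi.single p 1) ∧
        ∃ i ∉ S, ∀ j ∉ S, j ≠ i → mv h u j = 0 := by
  induction N with
  | zero =>
    intro u hu
    refine ⟨1, K.one_mem, fun p _ => mv_one _, k, hk, fun j hj _ => ?_⟩
    have := Finset.sum_eq_zero_iff.mp (Nat.le_zero.mp hu) j (by simpa using hj)
    simpa using this
  | succ N ih =>
    intro u hu
    by_cases h : ∃ i ∉ S, ∃ j ∉ S, i ≠ j ∧ u j ≠ 0 ∧ (u j).natAbs ≤ (u i).natAbs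
    · obtain ⟨i, hi, j, hj, hij, hj0, hle⟩ := h
      obtain ⟨c, hc⟩ : ∃ c : ℤ, (u i + c * u j).natAbs < (u i).natAbs := by
        rcases le_total 0 (u i * u j) with h0 | h0
        · refine ⟨-1, ?_⟩
          rcases mul_nonneg_iff.mp h0 with h0 | h0 <;> omega
        · refine ⟨1, ?_⟩
          rcases mul_nonpos_iff.mp h0 with h0 | h0 <;> omega
      have hv : (Pi.single i c : Fin n → ℤ) j = 0 := by simp [hij.symm]
      obtain ⟨h, hhK, hhS, hh⟩ := ih (mv (tv (Pi.single i c) (Pi.single j 1)) u) (by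
        refine Nat.lt_succ_iff.mp (lt_of_lt_of_le (Finset.sum_lt_sum (fun l _ => ?_) ⟨i, ?_, ?_⟩) hu)
        · rw [mv_tv_single hv]
          by_cases hl : l = i
          · subst hl; simpa [mul_comm] using hc.le
          · simp [hl]
        · simpa using hi
        · rw [mv_tv_single hv]; simpa [mul_comm] using hc)
      refine ⟨h * tv (Pi.single i c) (Pi.single j 1), K.mul_mem hhK (tv_single_mem hK hv),
        fun p hp => ?_, ?_⟩
      · rw [mv_mul, mv_tv_single hv, ← hhS p hp]
        have : p ≠ j := fun h => hj (h ▸ hp)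
        simp [this.symm, hhS p hp]
      · simpa only [mv_mul] using hh
    · push Not at h
      by_cases hne : ∃ i ∉ S, u i ≠ 0
      · obtain ⟨i, hi, hi0⟩ := hne
        refine ⟨1, K.one_mem, fun p _ => mv_one _, i, hi, fun j hj hji => ?_⟩
        rw [mv_one]
        by_contra hj0
        have h1 := h i hi j hj hji.symm hj0
        have h2 := h j hj i hi hji hi0
        omega
      · push Not at hne
        exact ⟨1, K.one_mem, fun p _ => mv_one _, k, hk, fun j hj _ => by simpa using hne j hj⟩

theorem mv_inv_single {g : SLZ n} {p : Fin n} (h : mv g (Pi.single p 1) = Pi.single p 1) :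
    mv g⁻¹ (Pi.single p 1) = Pi.single p 1 := by
  conv_lhs => rw [← h, mv_inv_mv]

theorem exists_mv_eq_one {K : Subgroup (SLZ n)}
    (hK : ∀ i j, i ≠ j → tv (Pi.single i 1) (Pi.single j 1) ∈ K) (S : Finset (Fin n))
    {k : Fin n} (hk : k ∉ S) (g : SLZ n)
    (hg : ∀ p ∈ S, mv g (Pi.single p 1) = Pi.single p 1) :
    ∃ h ∈ K, (∀ p ∈ S, mv h (Pi.single p 1) = Pi.single p 1) ∧
      mv h (mv g (Pi.single k 1)) k = 1 := by
  by_cases hS : ∃ j ∉ S, j ≠ k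
  · obtain ⟨j, hj, hjk⟩ := hS
    obtain ⟨h, hhK, hhS, i, hi, hu⟩ := exists_mv_eq_zero hK S hk _ (mv g (Pi.single k 1)) le_rfl
    set u := mv h (mv g (Pi.single k 1)) with hudef
    have hunit : IsUnit (u i) := by
      have h1 : mv (h * g)⁻¹ u k = 1 := by
        rw [hudef, ← mv_mul h g, mv_inv_mv]; simp
      have h2 : mv (h * g)⁻¹ u k = ∑ l, (h * g)⁻¹.1 k l * u l := rfl
      rw [h2, Finset.sum_eq_single i] at h1
      · exact IsUnit.of_mul_eq_one_right _ h1
      · intro l _ hl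
        by_cases hlS : l ∈ S
        · rw [← mv_single, mv_inv_single (by rw [mv_mul, hg l hlS, hhS l hlS])]
          have : k ≠ l := fun h => hk (h ▸ hlS)
          simp [this]
        · rw [hu l hlS hl, mul_zero]
      · simp
    have fix : ∀ a b c, b ∉ S → ∀ p ∈ S, a ≠ b →
        mv (tv (Pi.single a c) (Pi.single b 1)) (Pi.single p 1) = Pi.single p 1 := by
      intro a b c hb p hp hab
      have : b ≠ p := fun h => hb (h ▸ hp)
      rw [mv_tv_single (by simp [hab.symm])]
      simp [this]
    have mem : ∀ a b c, a ≠ b → tv (Pi.single a c : Fin n → ℤ) (Pi.single b 1) ∈ K :=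
      fun a b c hab => tv_single_mem hK (by simp [hab.symm])
    by_cases hik : i = k
    · subst hik
      rcases Int.isUnit_iff.mp hunit with h1 | h1
      · exact ⟨h, hhK, hhS, h1⟩
      · refine ⟨tv (Pi.single i 2) (Pi.single j 1) * (tv (Pi.single j (-1)) (Pi.single i 1) * h),
          K.mul_mem (mem _ _ _ hjk.symm) (K.mul_mem (mem _ _ _ hjk) hhK), fun p hp => ?_, ?_⟩
        · rw [mv_mul, mv_mul, hhS p hp, fix _ _ _ hi p hp hjk, fix _ _ _ hj p hp hjk.symm]
        · rw [mv_mul, mv_mul, ← hudef, mv_tv_single (by simp [hjk]), mv_tv_single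
            (by simp [hjk.symm])]
          simp [h1, hjk.symm, hu j hj hjk]
    · refine ⟨tv (Pi.single k (u i)) (Pi.single i 1) * h,
        K.mul_mem (mem _ _ _ (Ne.symm hik)) hhK, fun p hp => ?_, ?_⟩
      · rw [mv_mul, hhS p hp, fix _ _ _ hi p hp (Ne.symm hik)]
      · rw [mv_mul, ← hudef, mv_tv_single (by simp [hik])]
        rcases Int.isUnit_iff.mp hunit with h1 | h1 <;> simp [h1, hu k hk (Ne.symm hik)]
  · push Not at hS
    refine ⟨1, K.one_mem, fun p _ => mv_one _, ?_⟩
    have h1 : g.1 = (1 : Matrix (Fin n) (Fin n) ℤ).updateCol k (mv g (Pi.single k 1)) := by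
      ext a b
      by_cases hb : b = k
      · subst hb; simp [mv_single]
      · have hbS : b ∈ S := by by_contra hbS; exact hb (hS b hbS)
        rw [updateCol_ne hb, ← mv_single, hg b hbS, one_apply]
        simp [Pi.single_apply]
    have h2 := g.2
    rw [h1, ← cramer_apply, cramer_one] at h2
    simpa using h2

/-- The elementary transvections generate `SL(n,ℤ)`. -/
theorem eq_top_of_tv_single_mem {K : Subgroup (SLZ n)}
    (hK : ∀ i j, i ≠ j → tv (Pi.single i 1) (Pi.single j 1) ∈ K) : K = ⊤ := by
  have key : ∀ (m : ℕ) (S : Finset (Fin n)), Sᶜ.card = m → ∀ g : SLZ n,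
      (∀ p ∈ S, mv g (Pi.single p 1) = Pi.single p 1) → g ∈ K := by
    intro m
    induction m with
    | zero =>
      intro S hS g hg
      have hS' : S = Finset.univ := by simpa using hS
      have : g = 1 := by
        refine Subtype.ext (Matrix.ext fun a b => ?_)
        rw [← mv_single, hg b (by simp [hS'])]
        change _ = (1 : Matrix (Fin n) (Fin n) ℤ) a b
        rw [one_apply]
        simp [Pi.single_apply]
      rw [this]; exact K.one_mem
    | succ m ih =>
      intro S hS g hg
      obtain ⟨k, hk⟩ : Sᶜ.Nonempty := by rw [← Finset.card_pos]; omega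
      rw [Finset.mem_compl] at hk
      obtain ⟨h, hhK, hhS, hk1⟩ := exists_mv_eq_one hK S hk g hg
      set u := mv h (mv g (Pi.single k 1)) with hu
      have hv : (Pi.single k 1 - u : Fin n → ℤ) k = 0 := by simp [hk1]
      have := ih (insert k S) (by
        rw [Finset.compl_insert, Finset.card_erase_of_mem (by simpa using hk), hS]; rfl)
        (tv (Pi.single k 1 - u) (Pi.single k 1) * (h * g)) (by
          intro p hp
          rw [mv_mul, mv_mul, mv_tv_single hv]
          rcases Finset.mem_insert.mp hp with rfl | hp
          · rw [← hu, hk1]; simp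
          · have : k ≠ p := fun h => hk (h ▸ hp)
            rw [hg p hp, hhS p hp]; simp [this])
      rwa [K.mul_mem_cancel_left (tv_single_mem hK hv), K.mul_mem_cancel_left hhK] at this
  exact (Subgroup.eq_top_iff' K).mpr fun g => key _ ∅ rfl g (by simp)

end Generation

section Extension

open Filter

variable {n : ℕ}

theorem eventually_le_abs_add_mul (A a B b : ℤ) (h : B < |A|) :
    ∀ᶠ r : ℕ in atTop, r * B + b ≤ |a + r * A| := by
  filter_upwards [eventually_ge_atTop (|a| + |b|).toNat] with r hr
  have hr' : |a| + |b| ≤ (r : ℤ) := by omega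
  have h1 : |(r : ℤ) * A| - |a| ≤ |a + r * A| := by
    have := abs_sub_abs_le_abs_sub ((r : ℤ) * A) (-a)
    rwa [abs_neg, sub_neg_eq_add, add_comm (_ * _)] at this
  rw [abs_mul, Nat.abs_cast] at h1
  have h2 := le_abs_self b
  have h3 : (0 : ℤ) ≤ r := Int.natCast_nonneg r
  nlinarith [mul_le_mul_of_nonneg_left (Int.add_one_le_iff.mpr h) h3]

/-- The vector `w` is far from the fixed hyperplanes of the pairs in `F` and from the
coordinate hyperplanes. -/
def VecOK (F : Set ((Fin n → ℤ) × (Fin n → ℤ))) (w : Fin n → ℤ) : Prop :=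
  (∀ k, w k ≠ 0) ∧ ∀ q ∈ F, nrm w < |q.2 ⬝ᵥ w|

/-- The covector `g` is positive and far from the hyperplanes orthogonal to the pairs in `F`. -/
def CovOK (F : Set ((Fin n → ℤ) × (Fin n → ℤ))) (g : Fin n → ℤ) : Prop :=
  (∀ k, 0 < g k) ∧ ∀ q ∈ F, nrm g < |g ⬝ᵥ q.1|

variable {F : Set ((Fin n → ℤ) × (Fin n → ℤ))}

theorem VecOK.smul {w : Fin n → ℤ} (h : VecOK F w) {c : ℤ} (hc : c ≠ 0) : VecOK F (c • w) := by
  refine ⟨fun k => by simpa [hc] using h.1 k, fun q hq => ?_⟩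
  rw [nrm_smul, dotProduct_smul, smul_eq_mul, abs_mul]
  exact mul_lt_mul_of_pos_left (h.2 q hq) (abs_pos.mpr hc)

theorem CovOK.smul {g : Fin n → ℤ} (h : CovOK F g) {c : ℤ} (hc : 0 < c) : CovOK F (c • g) := by
  refine ⟨fun k => by simpa [hc] using h.1 k, fun q hq => ?_⟩
  rw [nrm_smul, smul_dotProduct, smul_eq_mul, abs_mul]
  exact mul_lt_mul_of_pos_left (h.2 q hq) (abs_pos.mpr hc.ne')

theorem VecOK.insert {w : Fin n → ℤ} (h : VecOK F w) {p : (Fin n → ℤ) × (Fin n → ℤ)}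
    (hp : nrm w < |p.2 ⬝ᵥ w|) : VecOK (insert p F) w :=
  ⟨h.1, by rintro q (rfl | hq); exacts [hp, h.2 q hq]⟩

theorem CovOK.insert {g : Fin n → ℤ} (h : CovOK F g) {p : (Fin n → ℤ) × (Fin n → ℤ)}
    (hp : nrm g < |g ⬝ᵥ p.1|) : CovOK (insert p F) g :=
  ⟨h.1, by rintro q (rfl | hq); exacts [hp, h.2 q hq]⟩

theorem Admissible.insert (hF : Admissible F) {p : (Fin n → ℤ) × (Fin n → ℤ)} (hp : GoodPair p)
    (h : ∀ q ∈ F, Compat p q ∧ Compat q p) : Admissible (insert p F) where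
  good := by rintro q (rfl | hq); exacts [hp, hF.good q hq]
  compat := hF.compat.insert fun q hq _ => h q hq

theorem eventually_admissible_insert (hfin : F.Finite) (hF : Admissible F) {w g : Fin n → ℤ}
    (hw : VecOK F w) (hg : CovOK F g) (a φ : Fin n → ℤ)
    (hdot : ∀ r : ℕ, (φ + (r : ℤ) • g) ⬝ᵥ (a + (r : ℤ) • w) = 0) :
    ∀ᶠ r : ℕ in atTop, Admissible (insert (a + (r : ℤ) • w, φ + (r : ℤ) • g) F) := by
  have h1 : ∀ᶠ r : ℕ in atTop, ∀ k, 2 ≤ |(a + (r : ℤ) • w) k| := by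
    rw [eventually_all]
    intro k
    simpa using eventually_le_abs_add_mul (w k) (a k) 0 2 (abs_pos.mpr (hw.1 k))
  have h2 : ∀ᶠ r : ℕ in atTop, ∀ k, 2 ≤ (φ + (r : ℤ) • g) k := by
    rw [eventually_all]
    intro k
    filter_upwards [eventually_ge_atTop (2 - φ k).toNat] with r hr
    have := hg.1 k
    have hr' : 2 - φ k ≤ (r : ℤ) := by omega
    simp only [Pi.add_apply, Pi.smul_apply, smul_eq_mul]
    nlinarith
  have h3 : ∀ᶠ r : ℕ in atTop, ∀ q ∈ F, Compat (a + (r : ℤ) • w, φ + (r : ℤ) • g) q := by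
    rw [eventually_all_finite hfin]
    intro q hq
    filter_upwards [eventually_le_abs_add_mul (g ⬝ᵥ q.1) (φ ⬝ᵥ q.1) (nrm g)
      (nrm q.1 + nrm φ + 1) (hg.2 q hq)] with r hr
    have h4 := nrm_add_le φ ((r : ℤ) • g)
    rw [nrm_smul, Nat.abs_cast] at h4
    simp only [Compat, add_dotProduct, smul_dotProduct, smul_eq_mul]
    linarith
  have h4 : ∀ᶠ r : ℕ in atTop, ∀ q ∈ F, Compat q (a + (r : ℤ) • w, φ + (r : ℤ) • g) := by
    rw [eventually_all_finite hfin]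
    intro q hq
    filter_upwards [eventually_le_abs_add_mul (q.2 ⬝ᵥ w) (q.2 ⬝ᵥ a) (nrm w)
      (nrm q.2 + nrm a + 1) (hw.2 q hq)] with r hr
    have h4 := nrm_add_le a ((r : ℤ) • w)
    rw [nrm_smul, Nat.abs_cast] at h4
    simp only [Compat, dotProduct_add, dotProduct_smul, smul_eq_mul]
    linarith
  filter_upwards [h1, h2, h3, h4] with r h1 h2 h3 h4
  exact hF.insert ⟨hdot r, h2, h1⟩ fun q hq => ⟨h3 q hq, h4 q hq⟩

theorem eventually_admissible_insert_smul (hfin : F.Finite) (hF : Admissible F)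
    {w g : Fin n → ℤ} (hw : VecOK F w) (hg : CovOK F g) (hdot : g ⬝ᵥ w = 0) :
    ∀ᶠ r : ℕ in atTop, Admissible (insert ((r : ℤ) • w, (r : ℤ) • g) F) := by
  simpa using eventually_admissible_insert hfin hF hw hg 0 0 fun r => by
    rw [zero_add, zero_add, smul_dotProduct, dotProduct_smul, hdot, smul_zero, smul_zero]

theorem eventually_vecOK_insert {w w' g : Fin n → ℤ} (h : VecOK F w') (hg : g ⬝ᵥ w' ≠ 0) :
    ∀ᶠ r : ℕ in atTop, VecOK (insert ((r : ℤ) • w, (r : ℤ) • g) F) w' := by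
  filter_upwards [eventually_le_abs_add_mul (g ⬝ᵥ w') 0 0 (nrm w' + 1) (abs_pos.mpr hg)] with r hr
  refine h.insert ?_
  simp only [smul_dotProduct, smul_eq_mul]
  simp only [mul_zero, zero_add] at hr
  linarith

theorem eventually_covOK_insert {w g g' : Fin n → ℤ} (h : CovOK F g') (hg : g' ⬝ᵥ w ≠ 0) :
    ∀ᶠ r : ℕ in atTop, CovOK (insert ((r : ℤ) • w, (r : ℤ) • g) F) g' := by
  filter_upwards [eventually_le_abs_add_mul (g' ⬝ᵥ w) 0 0 (nrm g' + 1) (abs_pos.mpr hg)] with r hr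
  refine h.insert ?_
  simp only [dotProduct_smul, smul_eq_mul]
  simp only [mul_zero, zero_add] at hr
  linarith

theorem tvGroup_mono {S T : Set ((Fin n → ℤ) × (Fin n → ℤ))} (h : S ⊆ T) :
    tvGroup S ≤ tvGroup T :=
  Subgroup.closure_mono (Set.image_mono h)

/-- Conjugating two generators by powers of `tv v f` and combining them produces the
transvection `tv w₂ (A • g₂)`. -/
theorem tv_combination {v f w₂ g₀ g₁ : Fin n → ℤ} {θ β : ℤ} (hfv : f ⬝ᵥ v = 0)
    (hfw : f ⬝ᵥ w₂ = θ) (hg₀v : g₀ ⬝ᵥ v = β) (hg₁v : g₁ ⬝ᵥ v = β)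
    (hg₀ : g₀ ⬝ᵥ w₂ = 2 * θ * β) (hg₁ : g₁ ⬝ᵥ w₂ = θ * β) (N N' : ℤ) :
    (tv v f * tv (N' • (w₂ - θ • v)) (N' • g₁) * (tv v f)⁻¹) ^ (2 * N ^ 2) *
      (tv v f ^ 2 * tv (N • (w₂ - (2 * θ) • v)) (N • g₀) * (tv v f ^ 2)⁻¹) ^ (-N' ^ 2) =
      tv w₂ ((N ^ 2 * N' ^ 2) • ((2 : ℤ) • g₁ - g₀)) := by
  have h0 : (N • g₀) ⬝ᵥ (N • (w₂ - (2 * θ) • v)) = 0 := by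
    simp only [smul_dotProduct, dotProduct_smul, dotProduct_sub, smul_eq_mul, hg₀, hg₀v]; ring
  have h1 : (N' • g₁) ⬝ᵥ (N' • (w₂ - θ • v)) = 0 := by
    simp only [smul_dotProduct, dotProduct_smul, dotProduct_sub, smul_eq_mul, hg₁, hg₁v]; ring
  have h2 : ((2 : ℤ) • f) ⬝ᵥ v = 0 := smul_dotProduct_zero hfv 2
  have e0 : (g₀ - (2 * β) • f) ⬝ᵥ w₂ = 0 := by
    simp only [smul_dotProduct, sub_dotProduct, smul_eq_mul, hg₀, hfw]; ring
  have e1 : (g₁ - β • f) ⬝ᵥ w₂ = 0 := by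
    simp only [smul_dotProduct, sub_dotProduct, smul_eq_mul, hg₁, hfw]; ring
  have c1 : tv v f * tv (N' • (w₂ - θ • v)) (N' • g₁) * (tv v f)⁻¹ =
      tv w₂ (N' ^ 2 • (g₁ - β • f)) := by
    rw [tv_conj_tv hfv h1, show N' ^ 2 • (g₁ - β • f) = N' • N' • (g₁ - β • f) by
      rw [smul_smul, sq], ← tv_smul_left (smul_dotProduct_zero e1 _)]
    congr 1
    · simp only [dotProduct_smul, dotProduct_sub, smul_eq_mul, hfw, hfv]; module
    · simp only [smul_dotProduct, smul_eq_mul, hg₁v]; module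
  have c0 : tv v f ^ 2 * tv (N • (w₂ - (2 * θ) • v)) (N • g₀) * (tv v f ^ 2)⁻¹ =
      tv w₂ (N ^ 2 • (g₀ - (2 * β) • f)) := by
    rw [tv_pow hfv, Nat.cast_ofNat, tv_conj_tv h2 h0,
      show N ^ 2 • (g₀ - (2 * β) • f) = N • N • (g₀ - (2 * β) • f) by
      rw [smul_smul, sq], ← tv_smul_left (smul_dotProduct_zero e0 _)]
    congr 1
    · simp only [smul_dotProduct, dotProduct_smul, dotProduct_sub, smul_eq_mul, hfw, hfv]; module
    · simp only [smul_dotProduct, smul_eq_mul, hg₀v]; module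
  have d0 := smul_dotProduct_zero e0 (N ^ 2)
  have d1 := smul_dotProduct_zero e1 (N' ^ 2)
  rw [c0, c1, tv_zpow d0, tv_zpow d1,
    tv_mul_tv (smul_dotProduct_zero d1 _) (smul_dotProduct_zero d0 _)]
  congr 1
  module

theorem exists_admissible_of_directions (hfin : F.Finite) (hF : Admissible F)
    {v f w₂ g₀ g₁ : Fin n → ℤ} {θ β : ℤ} (hθ : θ ≠ 0) (hβ : β ≠ 0) (hfv : f ⬝ᵥ v = 0)
    (hfw : f ⬝ᵥ w₂ = θ) (hg₀v : g₀ ⬝ᵥ v = β) (hg₁v : g₁ ⬝ᵥ v = β)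
    (hg₀ : g₀ ⬝ᵥ w₂ = 2 * θ * β) (hg₁ : g₁ ⬝ᵥ w₂ = θ * β)
    (hw₂F : VecOK F w₂) (hw₁F : VecOK F (w₂ - θ • v)) (hw₀F : VecOK F (w₂ - (2 * θ) • v))
    (hg₀F : CovOK F g₀) (hg₁F : CovOK F g₁) (hg₂F : CovOK F ((2 : ℤ) • g₁ - g₀))
    {i j : Fin n} (hij : i ≠ j) :
    ∃ F' : Set ((Fin n → ℤ) × (Fin n → ℤ)), F ⊆ F' ∧ F'.Finite ∧ Admissible F' ∧
      ∀ K : Subgroup (SLZ n), tvGroup F' ≤ K → tv v f ∈ K →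
        tv (Pi.single i 1) (Pi.single j 1) ∈ K := by
  have hθβ : θ * β ≠ 0 := mul_ne_zero hθ hβ
  obtain ⟨N, ⟨hN, hN0⟩, ⟨hw₁F₁, hw₂F₁⟩, hg₁F₁, hg₂F₁⟩ :=
    (((eventually_admissible_insert_smul hfin hF hw₀F hg₀F (by
      simp only [dotProduct_smul, dotProduct_sub, smul_eq_mul, hg₀, hg₀v]; ring)).and
      (eventually_ne_atTop 0)).and
      (((eventually_vecOK_insert (w := w₂ - (2 * θ) • v) (g := g₀) hw₁F (by
          simp only [dotProduct_smul, dotProduct_sub, smul_eq_mul, hg₀, hg₀v]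
          contrapose! hθβ; linarith)).and
        (eventually_vecOK_insert (w := w₂ - (2 * θ) • v) (g := g₀) hw₂F (by
          rw [hg₀]; contrapose! hθβ; linarith))).and
      ((eventually_covOK_insert (w := w₂ - (2 * θ) • v) (g := g₀) hg₁F (by
          simp only [dotProduct_smul, dotProduct_sub, smul_eq_mul, hg₁, hg₁v]
          contrapose! hθβ; linarith)).and
        (eventually_covOK_insert (w := w₂ - (2 * θ) • v) (g := g₀) hg₂F (by
          simp only [dotProduct_smul, dotProduct_sub, smul_eq_mul, sub_dotProduct,
            smul_dotProduct, hg₁, hg₁v, hg₀, hg₀v]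
          contrapose! hθβ; linarith))))).exists
  set p₀ : (Fin n → ℤ) × (Fin n → ℤ) := ((N : ℤ) • (w₂ - (2 * θ) • v), (N : ℤ) • g₀)
  obtain ⟨N', ⟨hN', hN'0⟩, hw₂F₂, hg₂F₂⟩ :=
    (((eventually_admissible_insert_smul (hfin.insert p₀) hN hw₁F₁ hg₁F₁ (by
      simp only [dotProduct_smul, dotProduct_sub, smul_eq_mul, hg₁, hg₁v]; ring)).and
      (eventually_ne_atTop 0)).and
      ((eventually_vecOK_insert (w := w₂ - θ • v) (g := g₁) hw₂F₁ (by rwa [hg₁])).and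
        (eventually_covOK_insert (w := w₂ - θ • v) (g := g₁) hg₂F₁ (by
          simp only [dotProduct_smul, dotProduct_sub, smul_eq_mul, sub_dotProduct,
            smul_dotProduct, hg₁, hg₁v, hg₀, hg₀v]
          contrapose! hθβ; linarith)))).exists
  set p₁ : (Fin n → ℤ) × (Fin n → ℤ) := ((N' : ℤ) • (w₂ - θ • v), (N' : ℤ) • g₁)
  set g₂ := (2 : ℤ) • g₁ - g₀ with hg₂
  set A : ℤ := (N : ℤ) ^ 2 * (N' : ℤ) ^ 2
  have hA0 : 0 < A := by positivity
  have hg₂w₂ : g₂ ⬝ᵥ w₂ = 0 := by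
    simp only [hg₂, sub_dotProduct, smul_dotProduct, hg₀, hg₁, smul_eq_mul]; ring
  obtain ⟨σ, hσ, hσj⟩ : ∃ σ : ℤ, σ ≠ 0 ∧ 0 < -σ * w₂ j := by
    refine ⟨-w₂ j, neg_ne_zero.mpr (hw₂F.1 j), ?_⟩
    rw [neg_neg]
    exact mul_self_pos.mpr (hw₂F.1 j)
  have hij' : (Pi.single j 1 : Fin n → ℤ) ⬝ᵥ Pi.single i 1 = 0 := by simp [hij]
  have hdot : ∀ r : ℕ, (Pi.single j 1 + (r : ℤ) • (A * (-σ * w₂ j)) • g₂) ⬝ᵥ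
      (Pi.single i 1 + (r : ℤ) • (σ * A * g₂ i) • w₂) = 0 := by
    intro r
    simp only [add_dotProduct, dotProduct_add, smul_dotProduct, dotProduct_smul, hg₂w₂,
      single_one_dotProduct, dotProduct_single_one, smul_eq_mul, Pi.add_apply, Pi.smul_apply,
      Pi.single_eq_of_ne hij]
    ring
  obtain ⟨r, hr⟩ := (eventually_admissible_insert ((hfin.insert p₀).insert p₁) hN'
    (hw₂F₂.smul (c := σ * A * g₂ i) (mul_ne_zero (mul_ne_zero hσ hA0.ne') (hg₂F.1 i).ne'))
    (hg₂F₂.smul (c := A * (-σ * w₂ j)) (mul_pos hA0 hσj)) (Pi.single i 1) (Pi.single j 1)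
    hdot).exists
  refine ⟨_, ?_, ((hfin.insert p₀).insert p₁).insert _, hr, fun K hK hh => ?_⟩
  · exact ((Set.subset_insert _ _).trans (Set.subset_insert _ _)).trans (Set.subset_insert _ _)
  have m0 : tv ((N : ℤ) • (w₂ - (2 * θ) • v)) ((N : ℤ) • g₀) ∈ K :=
    hK (tv_mem_tvGroup (p := p₀) (by simp))
  have m1 : tv ((N' : ℤ) • (w₂ - θ • v)) ((N' : ℤ) • g₁) ∈ K :=
    hK (tv_mem_tvGroup (p := p₁) (by simp))
  have m2 := hK (tv_mem_tvGroup (Set.mem_insert _ _))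
  have hh2 := K.pow_mem hh 2
  have mt : tv w₂ (A • g₂) ∈ K := by
    rw [← tv_combination hfv hfw hg₀v hg₁v hg₀ hg₁ N N']
    exact K.mul_mem (K.zpow_mem (K.mul_mem (K.mul_mem hh m1) (K.inv_mem hh)) _)
      (K.zpow_mem (K.mul_mem (K.mul_mem hh2 m0) (K.inv_mem hh2)) _)
  have dA := smul_dotProduct_zero hg₂w₂ A
  have mts := K.zpow_mem mt (σ * r)
  have e := tv_conj_tv (smul_dotProduct_zero dA (σ * r)) hij'
  rw [← tv_zpow dA] at e
  have e' : tv w₂ (A • g₂) ^ (σ * (r : ℤ)) * tv (Pi.single i 1) (Pi.single j 1) *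
      (tv w₂ (A • g₂) ^ (σ * (r : ℤ)))⁻¹ =
      tv (Pi.single i 1 + (r : ℤ) • (σ * A * g₂ i) • w₂)
        (Pi.single j 1 + (r : ℤ) • (A * (-σ * w₂ j)) • g₂) := by
    rw [e]
    congr 1
    · simp only [dotProduct_single_one, Pi.smul_apply, smul_eq_mul]; module
    · simp only [single_one_dotProduct]; module
  rw [← e'] at m2
  rwa [K.mul_mem_cancel_right (K.inv_mem mts), K.mul_mem_cancel_left mts] at m2

end Extension

section Directions

open Filter

variable {n : ℕ} {F : Set ((Fin n → ℤ) × (Fin n → ℤ))}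

theorem eventually_add_smul_ne_zero {z c : ℤ} (h : z = 0 → c ≠ 0) :
    ∀ᶠ T : ℕ in atTop, c + (T : ℤ) * z ≠ 0 := by
  by_cases hz : z = 0
  · exact Eventually.of_forall fun T => by simpa [hz] using h hz
  · filter_upwards [eventually_le_abs_add_mul z c 0 1 (abs_pos.mpr hz)] with T hT h0
    simp [h0] at hT

theorem eventually_vecOK (hfin : F.Finite) {z c : Fin n → ℤ}
    (hz : ∀ q ∈ F, nrm z < |q.2 ⬝ᵥ z|) (hc : ∀ p, z p = 0 → c p ≠ 0) :
    ∀ᶠ T : ℕ in atTop, VecOK F (c + (T : ℤ) • z) := by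
  have h1 : ∀ᶠ T : ℕ in atTop, ∀ p, (c + (T : ℤ) • z) p ≠ 0 := by
    rw [eventually_all]
    exact fun p => eventually_add_smul_ne_zero (hc p)
  have h2 : ∀ᶠ T : ℕ in atTop, ∀ q ∈ F, nrm (c + (T : ℤ) • z) < |q.2 ⬝ᵥ (c + (T : ℤ) • z)| := by
    rw [eventually_all_finite hfin]
    intro q hq
    filter_upwards [eventually_le_abs_add_mul (q.2 ⬝ᵥ z) (q.2 ⬝ᵥ c) (nrm z) (nrm c + 1)
      (hz q hq)] with T hT
    have h4 := nrm_add_le c ((T : ℤ) • z)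
    rw [nrm_smul, Nat.abs_cast] at h4
    simp only [dotProduct_add, dotProduct_smul, smul_eq_mul]
    linarith
  filter_upwards [h1, h2] with T h1 h2 using ⟨h1, h2⟩

theorem eventually_covOK (hfin : F.Finite) {y c : Fin n → ℤ}
    (hy : ∀ q ∈ F, nrm y < |y ⬝ᵥ q.1|) (hy0 : ∀ p, 0 ≤ y p) (hc : ∀ p, y p = 0 → 0 < c p) :
    ∀ᶠ T : ℕ in atTop, CovOK F (c + (T : ℤ) • y) := by
  have h1 : ∀ᶠ T : ℕ in atTop, ∀ p, 0 < (c + (T : ℤ) • y) p := by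
    rw [eventually_all]
    intro p
    rcases (hy0 p).eq_or_lt with h0 | h0
    · exact Eventually.of_forall fun T => by simpa [← h0] using hc p h0.symm
    · filter_upwards [eventually_ge_atTop (1 - c p).toNat] with T hT
      have hT' : 1 - c p ≤ (T : ℤ) := by omega
      simp only [Pi.add_apply, Pi.smul_apply, smul_eq_mul]
      nlinarith
  have h2 : ∀ᶠ T : ℕ in atTop, ∀ q ∈ F, nrm (c + (T : ℤ) • y) < |(c + (T : ℤ) • y) ⬝ᵥ q.1| := by
    rw [eventually_all_finite hfin]
    intro q hq
    filter_upwards [eventually_le_abs_add_mul (y ⬝ᵥ q.1) (c ⬝ᵥ q.1) (nrm y) (nrm c + 1)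
      (hy q hq)] with T hT
    have h4 := nrm_add_le c ((T : ℤ) • y)
    rw [nrm_smul, Nat.abs_cast] at h4
    simp only [add_dotProduct, smul_dotProduct, smul_eq_mul]
    linarith
  filter_upwards [h1, h2] with T h1 h2 using ⟨h1, h2⟩

theorem exists_pos_dotProduct_ne_zero {v : Fin n → ℤ} (hv : v ≠ 0) :
    ∃ κ : Fin n → ℤ, (∀ p, 0 < κ p) ∧ κ ⬝ᵥ v ≠ 0 := by
  by_cases h : (1 : Fin n → ℤ) ⬝ᵥ v = 0
  · obtain ⟨l, hl⟩ := Function.ne_iff.mp hv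
    refine ⟨1 + Pi.single l 1, fun p => ?_, ?_⟩
    · have : (0 : ℤ) ≤ (Pi.single l 1 : Fin n → ℤ) p := by
        rw [Pi.single_apply]; split_ifs <;> norm_num
      rw [Pi.add_apply, Pi.one_apply]
      linarith
    · rw [add_dotProduct, h, zero_add, single_one_dotProduct]
      exact hl
  · exact ⟨1, fun p => zero_lt_one, h⟩

theorem exists_admissible_extension (hn : 3 ≤ n) (hfin : F.Finite) (hF : Admissible F)
    {v f : Fin n → ℤ} (hv : v ≠ 0) (hfv : f ⬝ᵥ v = 0) (hf : Indefinite f) {i j : Fin n}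
    (hij : i ≠ j) :
    ∃ F' : Set ((Fin n → ℤ) × (Fin n → ℤ)), F ⊆ F' ∧ F'.Finite ∧ Admissible F' ∧
      ∀ K : Subgroup (SLZ n), tvGroup F' ≤ K → tv v f ∈ K →
        tv (Pi.single i 1) (Pi.single j 1) ∈ K := by
  obtain ⟨a, b, ha, hb⟩ := hf
  have hab : a ≠ b := by rintro rfl; linarith
  obtain ⟨k, hka, hkb⟩ := Fin.exists_ne_and_ne_of_two_lt a b hn
  obtain ⟨κ, hκ, hκv⟩ := exists_pos_dotProduct_ne_zero hv
  set z : Fin n → ℤ := Pi.single a (-f b) + Pi.single b (f a) with hz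
  have za : z a = -f b := by simp [hz, hab]
  have zb : z b = f a := by simp [hz, hab]
  have zk : z k = 0 := by simp [hz, hka, hkb]
  have z0 : ∀ p, 0 ≤ z p := by
    intro p
    rw [hz, Pi.add_apply, Pi.single_apply, Pi.single_apply]
    split_ifs <;> linarith
  have hfz : f ⬝ᵥ z = 0 := by
    rw [hz, dotProduct_add, dotProduct_single, dotProduct_single]; ring
  have hκz : 0 < κ ⬝ᵥ z := by
    refine Finset.sum_pos' (fun p _ => mul_nonneg (hκ p).le (z0 p)) ⟨a, Finset.mem_univ _, ?_⟩
    rw [za]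
    exact mul_pos (hκ a) (by linarith)
  have hzF : ∀ q ∈ F, nrm z < |q.2 ⬝ᵥ z| := by
    intro q hq
    have hpos := (hF.good q hq).pos
    have h1 : nrm z < q.2 ⬝ᵥ z := by
      refine Finset.sum_lt_sum (fun p _ => ?_) ⟨a, Finset.mem_univ _, ?_⟩
      · rw [abs_of_nonneg (z0 p)]
        nlinarith [hpos p, z0 p]
      · rw [abs_of_nonneg (z0 a), za]
        nlinarith [hpos a]
    exact h1.trans_le (le_abs_self _)
  set D : ℤ := 2 * nrm v + 1 with hD
  set ζ : Fin n → ℤ := Pi.single a (D * f a * ∑ p, f p + 1) - (D * f a ^ 2) • 1 with hζ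
  have hfζ : f ⬝ᵥ ζ = f a := by
    rw [hζ, dotProduct_sub, dotProduct_single, dotProduct_smul, dotProduct_one, smul_eq_mul]
    ring
  set c : ℤ → Fin n → ℤ := fun m => ζ + (m * f a) • v with hc
  have c_neg : ∀ m, 0 ≤ m → m ≤ 2 → ∀ p, p ≠ a → c m p < 0 := by
    intro m h0 h2 p hp
    have h3 : c m p = f a * (m * v p - D * f a) := by
      simp [hc, hζ, hp]; ring
    have h4 := abs_le_nrm v p
    have h5 := le_abs_self (v p)
    have h6 := abs_nonneg (v p)
    have h7 : m * v p ≤ 2 * |v p| := by nlinarith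
    have h8 : D ≤ D * f a := by nlinarith
    rw [h3]
    exact mul_neg_of_pos_of_neg ha (by linarith)
  have hw : ∀ m, 0 ≤ m → m ≤ 2 → ∀ᶠ T : ℕ in atTop, VecOK F (c m + (T : ℤ) • z) := by
    intro m h0 h2
    refine eventually_vecOK hfin hzF fun p hp => (c_neg m h0 h2 p ?_).ne
    rintro rfl
    linarith
  set y : Fin n → ℤ := Pi.single k (κ ⬝ᵥ z) with hy
  have hyF : ∀ q ∈ F, nrm y < |y ⬝ᵥ q.1| := by
    intro q hq
    have h1 : y = (κ ⬝ᵥ z) • Pi.single k 1 := by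
      rw [hy, ← Pi.single_smul, smul_eq_mul, mul_one]
    have h2 : nrm (Pi.single k 1 : Fin n → ℤ) = 1 := by
      rw [nrm, Finset.sum_eq_single k] <;> simp +contextual
    rw [h1, nrm_smul, h2, smul_dotProduct, single_one_dotProduct, smul_eq_mul, abs_mul]
    exact mul_lt_mul_of_pos_left (by linarith [(hF.good q hq).abs k]) (abs_pos.mpr hκz.ne')
  set d : ℤ → Fin n → ℤ := fun m => Pi.single k (κ ⬝ᵥ c m) - c m k • κ with hd
  have hg : ∀ m, 0 ≤ m → m ≤ 2 → ∀ᶠ T : ℕ in atTop, CovOK F (d m + (T : ℤ) • y) := by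
    intro m h0 h2
    refine eventually_covOK hfin hyF (fun p => ?_) fun p hp => ?_
    · rw [hy, Pi.single_apply]
      split_ifs <;> linarith
    · have hpk : p ≠ k := by
        rintro rfl
        rw [hy, Pi.single_eq_same] at hp
        linarith
      simp only [hd, Pi.sub_apply, Pi.single_eq_of_ne hpk, Pi.smul_apply, smul_eq_mul]
      nlinarith [c_neg m h0 h2 k hka, hκ p]
  have hβ : ∀ᶠ T : ℕ in atTop, (κ ⬝ᵥ ζ * v k - ζ k * κ ⬝ᵥ v) + (T : ℤ) * (κ ⬝ᵥ z * v k) ≠ 0 := by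
    refine eventually_add_smul_ne_zero fun h0 => ?_
    have hvk : v k = 0 := by
      rcases mul_eq_zero.mp h0 with h | h
      · linarith
      · exact h
    have := c_neg 0 le_rfl (by norm_num) k hka
    simp only [hc, zero_mul, zero_smul, add_zero] at this
    rw [hvk, mul_zero, zero_sub]
    exact neg_ne_zero.mpr (mul_ne_zero this.ne hκv)
  obtain ⟨T, ⟨⟨hw0, hw1, hw2⟩, hg0, hg1, hg2⟩, hβT⟩ :=
    ((((hw 0 (by norm_num) (by norm_num)).and ((hw 1 (by norm_num) (by norm_num)).and
      (hw 2 (by norm_num) (by norm_num)))).and ((hg 0 (by norm_num) (by norm_num)).and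
      ((hg 1 (by norm_num) (by norm_num)).and (hg 2 (by norm_num) (by norm_num))))).and hβ).exists
  have dv : ∀ m, (d m + (T : ℤ) • y) ⬝ᵥ v =
      (κ ⬝ᵥ ζ * v k - ζ k * κ ⬝ᵥ v) + (T : ℤ) * (κ ⬝ᵥ z * v k) := by
    intro m
    simp only [hd, hy, hc, add_dotProduct, sub_dotProduct, smul_dotProduct, single_dotProduct,
      dotProduct_add, dotProduct_smul, Pi.add_apply, Pi.smul_apply, smul_eq_mul]
    ring
  have dw : ∀ m, (d m + (T : ℤ) • y) ⬝ᵥ (c 2 + (T : ℤ) • z) =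
      (2 - m) * f a * ((κ ⬝ᵥ ζ * v k - ζ k * κ ⬝ᵥ v) + (T : ℤ) * (κ ⬝ᵥ z * v k)) := by
    intro m
    simp only [hd, hy, hc, add_dotProduct, sub_dotProduct, smul_dotProduct, single_dotProduct,
      dotProduct_add, dotProduct_smul, Pi.add_apply, Pi.smul_apply, smul_eq_mul, zk]
    ring
  have e1 : c 2 + (T : ℤ) • z - f a • v = c 1 + (T : ℤ) • z := by simp only [hc]; module
  have e0 : c 2 + (T : ℤ) • z - (2 * f a) • v = c 0 + (T : ℤ) • z := by simp only [hc]; module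
  have e2 : (2 : ℤ) • (d 1 + (T : ℤ) • y) - (d 0 + (T : ℤ) • y) = d 2 + (T : ℤ) • y := by
    have h1 : κ ⬝ᵥ c 2 = 2 * κ ⬝ᵥ c 1 - κ ⬝ᵥ c 0 := by
      simp only [hc, dotProduct_add, dotProduct_smul, smul_eq_mul]; ring
    have h2 : c 2 k = 2 * c 1 k - c 0 k := by
      simp only [hc, Pi.add_apply, Pi.smul_apply, smul_eq_mul]; ring
    have h3 : (Pi.single k (κ ⬝ᵥ c 2) : Fin n → ℤ) =
        (2 : ℤ) • Pi.single k (κ ⬝ᵥ c 1) - Pi.single k (κ ⬝ᵥ c 0) := by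
      rw [← Pi.single_smul, ← Pi.single_sub, h1, smul_eq_mul]
    simp only [hd, h3, h2]
    module
  refine exists_admissible_of_directions hfin hF ha.ne' hβT hfv ?_ (dv 0) (dv 1)
    ((dw 0).trans (by ring)) ((dw 1).trans (by ring)) hw2 (by rwa [e1]) (by rwa [e0]) hg0 hg1
    (by rwa [e2]) hij
  simp only [hc, dotProduct_add, dotProduct_smul, hfζ, hfv, hfz, smul_zero, add_zero]

end Directions

section Maximal

variable {n : ℕ}

theorem Admissible.singleton {p : (Fin n → ℤ) × (Fin n → ℤ)} (hp : GoodPair p) :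
    Admissible {p} where
  good := by rintro q rfl; exact hp
  compat := Set.pairwise_singleton _ _

theorem Admissible.iUnion {F : ℕ → Set ((Fin n → ℤ) × (Fin n → ℤ))} (hmono : Monotone F)
    (hF : ∀ m, Admissible (F m)) : Admissible (⋃ m, F m) where
  good := by
    intro p hp
    obtain ⟨m, hm⟩ := Set.mem_iUnion.mp hp
    exact (hF m).good p hm
  compat := (Set.pairwise_iUnion hmono.directed_le).mpr fun m => (hF m).compat

/-- A ping-pong group that generates `SL(n,ℤ)` together with any transvection whose fixed
hyperplane meets the open positive orthant. -/
theorem exists_admissible_generating (hn : 3 ≤ n) :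
    ∃ S : Set ((Fin n → ℤ) × (Fin n → ℤ)), Admissible S ∧
      (∃ p ∈ S, ∃ f, Indefinite f ∧ f ⬝ᵥ p.1 = 0) ∧
      ∀ v f : Fin n → ℤ, v ≠ 0 → f ⬝ᵥ v = 0 → Indefinite f →
        ∀ K : Subgroup (SLZ n), tvGroup S ≤ K → tv v f ∈ K → K = ⊤ := by
  let X := {F : Set ((Fin n → ℤ) × (Fin n → ℤ)) // F.Finite ∧ Admissible F}
  let τ := (Fin n → ℤ) × (Fin n → ℤ) × Fin n × Fin n
  have step : ∀ (t : τ) (F : X), ∃ F' : X, F.1 ⊆ F'.1 ∧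
      (t.1 ≠ 0 → t.2.1 ⬝ᵥ t.1 = 0 → Indefinite t.2.1 → t.2.2.1 ≠ t.2.2.2 →
        ∀ K : Subgroup (SLZ n), tvGroup F'.1 ≤ K → tv t.1 t.2.1 ∈ K →
          tv (Pi.single t.2.2.1 1) (Pi.single t.2.2.2 1) ∈ K) := by
    rintro ⟨v, f, i, j⟩ ⟨F, hfin, hF⟩
    by_cases h : v ≠ 0 ∧ f ⬝ᵥ v = 0 ∧ Indefinite f ∧ i ≠ j
    · obtain ⟨F', h1, h2, h3, h4⟩ := exists_admissible_extension hn hfin hF h.1 h.2.1 h.2.2.1 h.2.2.2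
      exact ⟨⟨F', h2, h3⟩, h1, fun _ _ _ _ => h4⟩
    · exact ⟨⟨F, hfin, hF⟩, subset_rfl, fun h1 h2 h3 h4 => absurd ⟨h1, h2, h3, h4⟩ h⟩
  choose next hnext hgen using step
  let i₀ : Fin n := ⟨0, by omega⟩
  let i₁ : Fin n := ⟨1, by omega⟩
  let i₂ : Fin n := ⟨2, by omega⟩
  have h01 : i₀ ≠ i₁ := by simp [i₀, i₁]
  have h02 : i₀ ≠ i₂ := by simp [i₀, i₂]
  have h12 : i₁ ≠ i₂ := by simp [i₁, i₂]
  let w : Fin n → ℤ := (2 : ℤ) • 1 + Pi.single i₀ (-2 * (n : ℤ))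
  have hp : GoodPair (w, (2 : ℤ) • 1) := by
    refine ⟨?_, fun k => by simp, fun k => ?_⟩
    · simp only [w, smul_dotProduct, dotProduct_add, one_dotProduct_one, dotProduct_smul,
        dotProduct_single, Fintype.card_fin, smul_eq_mul, Pi.smul_apply, Pi.one_apply]
      ring
    · simp only [w, Pi.add_apply, Pi.smul_apply, Pi.one_apply, smul_eq_mul, mul_one]
      by_cases hk : k = i₀
      · subst hk
        rw [Pi.single_eq_same, le_abs]
        right
        have : (3 : ℤ) ≤ n := by exact_mod_cast hn
        linarith
      · rw [Pi.single_eq_of_ne hk]; norm_num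
  have : Nonempty τ := ⟨(0, 0, i₀, i₀)⟩
  obtain ⟨e, he⟩ := exists_surjective_nat τ
  let seq : ℕ → X := fun m => Nat.rec
    ⟨{(w, (2 : ℤ) • 1)}, Set.finite_singleton _, Admissible.singleton hp⟩
    (fun m F => next (e m) F) m
  have hmono : Monotone fun m => (seq m).1 := monotone_nat_of_le_succ fun m => hnext (e m) (seq m)
  refine ⟨⋃ m, (seq m).1, Admissible.iUnion hmono fun m => (seq m).2.2,
    ⟨(w, (2 : ℤ) • 1), Set.mem_iUnion.mpr ⟨0, rfl⟩, Pi.single i₁ 1 - Pi.single i₂ 1,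
      ⟨i₁, i₂, by simp [h12], by simp [h12.symm]⟩, ?_⟩, ?_⟩
  · rw [sub_dotProduct, single_one_dotProduct, single_one_dotProduct]
    simp [w, h01.symm, h02.symm]
  · intro v f hv hfv hf K hK hh
    refine eq_top_of_tv_single_mem fun i j hij => ?_
    obtain ⟨m, hm⟩ := he (v, f, i, j)
    have := hgen (e m) (seq m)
    rw [hm] at this
    refine this hv hfv hf hij K (le_trans (tvGroup_mono ?_) hK) hh
    rw [← hm]
    exact Set.subset_iUnion (fun m => (seq m).1) (m + 1)

theorem exists_maximal_notMem {G : Type*} [Group G] {H : Subgroup G} {b : G} (hb : b ∉ H) :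
    ∃ M : Subgroup G, H ≤ M ∧ b ∉ M ∧ ∀ K, M < K → b ∈ K := by
  obtain ⟨M, hHM, hM⟩ := zorn_le_nonempty₀ {K : Subgroup G | b ∉ K} (fun c hc hchain y hy => by
    refine ⟨sSup c, ?_, fun z hz => le_sSup hz⟩
    rw [Set.mem_ofPred_eq, Subgroup.mem_sSup_of_directedOn ⟨y, hy⟩ hchain.directedOn]
    rintro ⟨K, hK, hbK⟩
    exact hc hK hbK) H hb
  refine ⟨M, hHM, hM.prop, fun K hK => ?_⟩
  by_contra hbK
  exact hK.not_ge (hM.le_of_ge hbK hK.le)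

/-- Adding a large multiple of `e₁ - e₀` to a nonzero semidefinite covector makes it indefinite. -/
theorem indefinite_add_smul {f φ : Fin n → ℤ} {i₀ i₁ : Fin n} (h0 : φ i₀ = -2) (h1 : φ i₁ = 2)
    (hf : f ≠ 0) (hind : ¬ Indefinite f) : Indefinite (f + (f ⬝ᵥ 1) • φ) := by
  obtain ⟨p, hp⟩ := Function.ne_iff.mp hf
  have hp : f p ≠ 0 := hp
  have e0 : (f + (f ⬝ᵥ 1) • φ) i₀ = f i₀ - 2 * ∑ k, f k := by
    rw [dotProduct_one, Pi.add_apply, Pi.smul_apply, h0, smul_eq_mul]; ring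
  have e1 : (f + (f ⬝ᵥ 1) • φ) i₁ = f i₁ + 2 * ∑ k, f k := by
    rw [dotProduct_one, Pi.add_apply, Pi.smul_apply, h1, smul_eq_mul]; ring
  rcases hp.lt_or_gt with hneg | hpos
  · have hle : ∀ k, f k ≤ 0 := fun k => not_lt.mp fun hk => hind ⟨k, p, hk, hneg⟩
    have hs : ∑ k, f k < 0 :=
      Finset.sum_neg' (fun k _ => hle k) ⟨p, Finset.mem_univ p, hneg⟩
    have hs0 : ∑ k, f k ≤ f i₀ := by
      rw [← Finset.add_sum_erase _ _ (Finset.mem_univ i₀)]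
      linarith [Finset.sum_nonpos (s := Finset.univ.erase i₀) fun k _ => hle k]
    refine ⟨i₀, i₁, ?_, ?_⟩
    · rw [e0]; linarith
    · rw [e1]; linarith [hle i₁]
  · have hge : ∀ k, 0 ≤ f k := fun k => not_lt.mp fun hk => hind ⟨p, k, hpos, hk⟩
    have hs : 0 < ∑ k, f k :=
      Finset.sum_pos' (fun k _ => hge k) ⟨p, Finset.mem_univ p, hpos⟩
    have hs0 : f i₀ ≤ ∑ k, f k :=
      Finset.single_le_sum (fun k _ => hge k) (Finset.mem_univ i₀)
    refine ⟨i₁, i₀, ?_, ?_⟩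
    · rw [e1]; linarith [hge i₁]
    · rw [e0]; linarith

theorem Indefinite.smul {f : Fin n → ℤ} (hf : Indefinite f) {c : ℤ} (hc : 0 < c) :
    Indefinite (c • f) := by
  obtain ⟨i, j, hi, hj⟩ := hf
  exact ⟨i, j, mul_pos hc hi, mul_neg_of_pos_of_neg hc hj⟩

theorem IsMaxSubgroup.isTrivialBlock {G : Type*} [Group G] {M : Subgroup G}
    (hM : IsMaxSubgroup M) {B : Set (G ⧸ M)} (hB : MulAction.IsBlock G B) :
    MulAction.IsTrivialBlock B := by
  by_cases hnt : Nontrivial (G ⧸ M)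
  · have : MulAction.IsPreprimitive G (G ⧸ M) := by
      rw [← MulAction.isCoatom_stabilizer_iff_preprimitive G ((1 : G) : G ⧸ M),
        MulAction.stabilizer_quotient]
      exact hM
    exact MulAction.IsPreprimitive.isTrivialBlock_of_isBlock hB
  · rw [not_nontrivial_iff_subsingleton] at hnt
    exact Or.inl Set.subsingleton_of_subsingleton

end Maximal

/-- Theorem 4 (Gelander–Meiri): for `n ≥ 3` there is an infinite-index maximal
subgroup `M ≤ SL(n,ℤ)` such that the action of `SL(n,ℤ)` on `SL(n,ℤ)/M` is
primitive (transitive with only trivial blocks) but not 2-transitive. -/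
theorem exists_primitive_not_two_transitive_action (n : ℕ) (hn : 3 ≤ n) :
    ∃ M : Subgroup (SLZ n), IsMaxSubgroup M ∧ M.index = 0 ∧
      MulAction.IsPretransitive (SLZ n) (SLZ n ⧸ M) ∧
      (∀ B : Set (SLZ n ⧸ M), MulAction.IsBlock (SLZ n) B → MulAction.IsTrivialBlock B) ∧
      ∃ x₁ y₁ x₂ y₂ : SLZ n ⧸ M, x₁ ≠ y₁ ∧ x₂ ≠ y₂ ∧
        ∀ g : SLZ n, ¬ (g • x₁ = x₂ ∧ g • y₁ = y₂) := by

  obtain ⟨S, hS, ⟨p, hpS, f', hf', hf'p⟩, hgen⟩ := exists_admissible_generating hn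
  let i₀ : Fin n := ⟨0, by omega⟩
  let i₁ : Fin n := ⟨1, by omega⟩
  have h01 : i₀ ≠ i₁ := by simp [i₀, i₁]
  let φ : Fin n → ℤ := Pi.single i₁ 2 - Pi.single i₀ 2
  have φ0 : φ i₀ = -2 := by simp [φ, h01]
  have φ1 : φ i₁ = 2 := by simp [φ, h01.symm]
  have hφ1 : φ ⬝ᵥ 1 = 0 := by simp [φ, dotProduct_one]
  have hφ : Indefinite φ := ⟨i₁, i₀, by rw [φ1]; norm_num, by rw [φ0]; norm_num⟩
  have one_ne : (1 : Fin n → ℤ) ≠ 0 := fun h => one_ne_zero (congrFun h i₀)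
  set b : SLZ n := tv 1 φ with hb
  have hbi : mv b (Pi.single i₁ 1) = Pi.single i₁ 1 + (2 : ℤ) • 1 := by
    rw [hb, mv_tv hφ1, dotProduct_single_one, φ1]
  have hbH : b ∉ tvGroup S := by
    refine notMem_tvGroup hS i₁ (fun k => ?_) fun h => ?_
    · rw [hbi, Pi.add_apply, Pi.single_apply]
      split_ifs <;> simp
    · rw [h, mv_one] at hbi
      have := congrFun hbi i₁
      simp at this
  obtain ⟨M, hHM, hbM, hmax⟩ := exists_maximal_notMem hbH
  have hind : ∀ v f : Fin n → ℤ, v ≠ 0 → f ⬝ᵥ v = 0 → tv v f ∈ M → ¬ Indefinite f :=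
    fun v f hv hfv hh hf => hbM (hgen v f hv hfv hf M hHM hh ▸ Subgroup.mem_top b)
  have hMmax : IsMaxSubgroup M :=
    ⟨fun h => hbM (h ▸ Subgroup.mem_top b),
      fun K hK => hgen 1 φ one_ne hφ1 hφ K (hHM.trans hK.le) (hmax K hK)⟩
  have hp := hS.good p hpS
  have hp1 : p.1 ≠ 0 := fun h => by simpa [h] using hp.abs i₀
  have hc : tv p.1 f' ∉ M := fun h => hind _ _ hp1 hf'p h hf'
  refine ⟨M, hMmax, ?_, inferInstance, fun B hB => hMmax.isTrivialBlock hB,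
    ((1 : SLZ n) : SLZ n ⧸ M), (tv p.1 f' : SLZ n ⧸ M), ((1 : SLZ n) : SLZ n ⧸ M),
    (b : SLZ n ⧸ M), ?_, ?_, ?_⟩
  · by_contra hidx
    obtain ⟨k, hk, -, hkM⟩ := Subgroup.exists_pow_mem_of_index_ne_zero hidx b
    rw [hb, tv_pow hφ1] at hkM
    exact hind _ _ one_ne (smul_dotProduct_zero hφ1 k) hkM (hφ.smul (by exact_mod_cast hk))
  · rwa [Ne, QuotientGroup.eq, inv_one, one_mul]
  · rwa [Ne, QuotientGroup.eq, inv_one, one_mul]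
  · rintro g ⟨hg1, hg2⟩
    have hgM : g ∈ M := by
      rw [MulAction.Quotient.smul_coe, eq_comm, QuotientGroup.eq] at hg1
      simpa using hg1
    have hgb : b⁻¹ * (g * tv p.1 f') ∈ M := by
      rw [MulAction.Quotient.smul_coe, eq_comm, QuotientGroup.eq] at hg2
      exact hg2
    have hh : tv p.1 p.2 ∈ M := hHM (tv_mem_tvGroup hpS)
    have hcomm : tv p.1 f' * tv p.1 p.2 * (tv p.1 f')⁻¹ = tv p.1 p.2 := by
      rw [tv_mul_tv hf'p hp.dot, add_comm, ← tv_mul_tv hp.dot hf'p, mul_inv_cancel_right]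
    have hv : mv g p.1 ≠ 0 := fun h => hp1 (by rw [← mv_inv_mv g p.1, h, mv_zero])
    have hfv := tv_conj_dotProduct hp.dot g
    have hf0 : cv p.2 g⁻¹ ≠ 0 := fun h => by
      have h1 : p.2 ⬝ᵥ mv g⁻¹ (mv g (Pi.single i₀ 1)) = 0 := by
        rw [dotProduct_mv, h, zero_dotProduct]
      rw [mv_inv_mv, dotProduct_single_one] at h1
      linarith [hp.pos i₀]
    have hconj : tv (mv g p.1) (cv p.2 g⁻¹) ∈ M := by
      rw [← tv_conj hp.dot]
      exact M.mul_mem (M.mul_mem hgM hh) (M.inv_mem hgM)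
    have hconj' : tv (mv b⁻¹ (mv g p.1)) (cv (cv p.2 g⁻¹) b⁻¹⁻¹) ∈ M := by
      rw [← tv_conj hfv, ← tv_conj hp.dot, ← hcomm]
      have := M.mul_mem (M.mul_mem hgb hh) (M.inv_mem hgb)
      convert this using 1
      group
    refine hind _ _ (fun h => hv ?_) (tv_conj_dotProduct hfv b⁻¹) hconj' ?_
    · rw [← mv_mv_inv b (mv g p.1), h, mv_zero]
    · rw [inv_inv, hb, cv_tv hφ1]
      exact indefinite_add_smul φ0 φ1 hf0 (hind _ _ hv hfv hconj)
end

section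
/- Let n ≥ 3. For every 1-dimensional ℚ-subspace p of ℚⁿ and every (n−1)-dimensional ℚ-subspace L of ℚⁿ with p ⊆ L, there exists u ∈ SL(n,ℤ) such that, regarding u as a ℚ-linear automorphism of ℚⁿ, the map u − I has rank 1, is nilpotent, and satisfies Im(u − I) = p and ker(u − I) = L. -/
/- Common setup: `SL(n,ℤ)`, `SL(n,ℝ)`, the real projective space `ℙ^{n-1}(ℝ)`
with its quotient topology and the projective action, rank-1 unipotent elements
and their attracting points / fixed hyperplanes, metrics compatible with the
topology of `ℙ`, `ε`-neighbourhoods, Schottky systems, profinite density,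
maximal subgroups, and lattices in `SL(n,ℝ)`. -/

open Matrix LinearAlgebra.Projectivization

/-- Every vector over `ℚ` becomes integral after scaling by a nonzero rational. -/
theorem exists_smul_eq_intCast {n : ℕ} (x : Fin n → ℚ) :
    ∃ c : ℚ, c ≠ 0 ∧ ∃ v : Fin n → ℤ, c • x = fun i => (v i : ℚ) := by
  obtain ⟨b, hb⟩ := IsLocalization.exist_integer_multiples_of_finite (nonZeroDivisors ℤ) x
  choose v hv using hb
  refine ⟨((b : ℤ) : ℚ), Int.cast_ne_zero.2 (nonZeroDivisors.coe_ne_zero b), v, ?_⟩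
  ext i
  simpa using (hv i).symm

/-- A rational line is spanned by an integral vector. -/
theorem exists_eq_span_intCast {n : ℕ} {p : Submodule ℚ (Fin n → ℚ)}
    (hp : Module.finrank ℚ p = 1) :
    ∃ v : Fin n → ℤ, p = Submodule.span ℚ {fun i => (v i : ℚ)} := by
  obtain ⟨⟨x, hxp⟩, -, hx⟩ := finrank_eq_one_iff'.1 hp
  obtain ⟨c, hc, v, hv⟩ := exists_smul_eq_intCast x
  refine ⟨v, ?_⟩
  rw [← hv, Submodule.span_singleton_smul_eq hc.isUnit]
  refine le_antisymm (fun y hy => ?_) ((Submodule.span_singleton_le_iff_mem _ _).2 hxp)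
  obtain ⟨a, ha⟩ := hx ⟨y, hy⟩
  exact Submodule.mem_span_singleton.2 ⟨a, congrArg Subtype.val ha⟩

/-- A rational hyperplane is the orthogonal complement of a nonzero integral vector. -/
theorem exists_mem_iff_dotProduct_intCast_eq_zero {n : ℕ} {L : Submodule ℚ (Fin n → ℚ)}
    (hL : Module.finrank ℚ L + 1 = n) :
    ∃ w : Fin n → ℤ, w ≠ 0 ∧ ∀ x, x ∈ L ↔ (fun i => (w i : ℚ)) ⬝ᵥ x = 0 := by
  have hlt : L < ⊤ := lt_top_iff_ne_top.2 fun h => by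
    have := (finrank_top ℚ (Fin n → ℚ))
    rw [← h, Module.finrank_fin_fun] at this
    omega
  obtain ⟨f, hf, hle⟩ := Submodule.exists_le_ker_of_lt_top L hlt
  have hker : L = LinearMap.ker f := by
    refine Submodule.eq_of_le_of_finrank_eq hle ?_
    have := Module.Dual.finrank_ker_add_one_of_ne_zero hf
    rw [Module.finrank_fin_fun] at this
    omega
  obtain ⟨c, hc, w, hw⟩ := exists_smul_eq_intCast ((dotProductEquiv ℚ (Fin n)).symm f)
  have hfx (x) : (fun i => (w i : ℚ)) ⬝ᵥ x = c * f x := by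
    rw [← hw, smul_dotProduct, smul_eq_mul, ← dotProductEquiv_apply_apply,
      LinearEquiv.apply_symm_apply]
  refine ⟨w, ?_, fun x => by simp [hfx, hc, hker]⟩
  rintro rfl
  refine hf (LinearMap.ext fun x => ?_)
  simpa [hc] using (hfx x).symm

/-- The integral transvection `x ↦ x + (w ⬝ᵥ x) v`, for `w ⬝ᵥ v = 0`. -/
def transvectionZ {n : ℕ} (v w : Fin n → ℤ) (h : w ⬝ᵥ v = 0) : SLZ n :=
  ⟨1 + vecMulVec v w, by
    rw [vecMulVec_eq Unit, det_one_add_replicateCol_mul_replicateRow, h, add_zero]⟩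

theorem linQ_transvectionZ_apply {n : ℕ} (v w : Fin n → ℤ) (h : w ⬝ᵥ v = 0) (x : Fin n → ℚ) :
    linQ (transvectionZ v w h) x =
      ((fun i => (w i : ℚ)) ⬝ᵥ x) • fun i => (v i : ℚ) := by
  have hm : matQ (transvectionZ v w h) - 1 =
      vecMulVec (fun i => (v i : ℚ)) (fun i => (w i : ℚ)) := by
    ext i j
    change (((1 + vecMulVec v w) i j : ℤ) : ℚ) - (1 : Matrix (Fin n) (Fin n) ℚ) i j = _
    by_cases hij : i = j <;> simp [vecMulVec_apply, one_apply, hij]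
  rw [linQ, hm, mulVecLin_apply, vecMulVec_mulVec]
  ext i
  simp [mul_comm]

/-- Half of Lemma 2.2 (structure of rank-1 unipotents): for every rational line
`p` inside a rational hyperplane `L` of `ℚⁿ` there is a rank-1 unipotent
`u ∈ SL(n,ℤ)` with `Im(u - I) = p` and `ker(u - I) = L`. -/
theorem exists_rank_one_unipotent_with_data (n : ℕ) (hn : 3 ≤ n)
    (p L : Submodule ℚ (Fin n → ℚ))
    (hp : Module.finrank ℚ p = 1) (hL : Module.finrank ℚ L = n - 1) (hpL : p ≤ L) :
    ∃ u : SLZ n, IsNilpotent (linQ u) ∧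
      Module.finrank ℚ (LinearMap.range (linQ u)) = 1 ∧
      LinearMap.range (linQ u) = p ∧ LinearMap.ker (linQ u) = L := by
  obtain ⟨v, hv⟩ := exists_eq_span_intCast hp
  obtain ⟨w, hw, hLw⟩ := exists_mem_iff_dotProduct_intCast_eq_zero (L := L) (by omega)
  have hv0 : (fun i => (v i : ℚ)) ≠ 0 := fun h => by
    rw [hv, h, Submodule.span_zero_singleton, finrank_bot] at hp
    exact zero_ne_one hp
  have hvL : (fun i => (w i : ℚ)) ⬝ᵥ (fun i => (v i : ℚ)) = 0 :=
    (hLw _).1 (hpL (hv ▸ Submodule.mem_span_singleton_self _))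
  have hwv : w ⬝ᵥ v = 0 := by
    simp only [dotProduct] at hvL ⊢
    exact_mod_cast hvL
  have happ := linQ_transvectionZ_apply v w hwv
  have hrange : LinearMap.range (linQ (transvectionZ v w hwv)) = p := by
    obtain ⟨i, hi⟩ := Function.ne_iff.1 hw
    have hi' : (w i : ℚ) ≠ 0 := Int.cast_ne_zero.2 hi
    refine le_antisymm ?_ ?_
    · rintro _ ⟨x, rfl⟩
      rw [happ, hv]
      exact Submodule.smul_mem _ _ (Submodule.mem_span_singleton_self _)
    · rw [hv, Submodule.span_singleton_le_iff_mem]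
      exact ⟨Pi.single i (w i : ℚ)⁻¹, by
        rw [happ, dotProduct_single, mul_inv_cancel₀ hi', one_smul]⟩
  refine ⟨transvectionZ v w hwv, ⟨2, LinearMap.ext fun x => ?_⟩, hrange ▸ hp, hrange, ?_⟩
  · rw [pow_two, Module.End.mul_apply, happ x, map_smul, happ, hvL]
    simp
  · ext x
    rw [LinearMap.mem_ker, happ, hLw, smul_eq_zero, or_iff_left hv0]
end

section
/- Let n ≥ 3 and let u, v ∈ SL(n,ℤ) be rank-1 unipotent elements. Then there exist nonzero integers r and s with u^s = v^r if and only if Im(u − I) = Im(v − I) and ker(u − I) = ker(v − I) (as ℚ-subspaces of ℚⁿ). -/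
/- Common setup: `SL(n,ℤ)`, `SL(n,ℝ)`, the real projective space `ℙ^{n-1}(ℝ)`
with its quotient topology and the projective action, rank-1 unipotent elements
and their attracting points / fixed hyperplanes, metrics compatible with the
topology of `ℙ`, `ε`-neighbourhoods, Schottky systems, profinite density,
maximal subgroups, and lattices in `SL(n,ℝ)`. -/

open Matrix LinearAlgebra.Projectivization

/-- A nilpotent endomorphism of rank one squares to zero. -/
lemma Module.End.mul_self_eq_zero_of_isNilpotent_of_finrank_range_eq_one
    {K V : Type*} [Field K] [AddCommGroup V] [Module K V] {f : Module.End K V}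
    (hf : IsNilpotent f) (h : Module.finrank K (LinearMap.range f) = 1) : f * f = 0 := by
  obtain ⟨⟨w, hw⟩, hw0, hspan⟩ := finrank_eq_one_iff'.1 h
  have hw0' : w ≠ 0 := fun h0 => hw0 (Subtype.ext h0)
  have key : ∀ x, ∃ t : K, t • w = f x := fun x => by
    obtain ⟨t, ht⟩ := hspan ⟨f x, x, rfl⟩
    exact ⟨t, congrArg Subtype.val ht⟩
  obtain ⟨c, hc⟩ := key w
  have hpow : ∀ k : ℕ, (f ^ k) w = c ^ k • w := fun k => by
    induction k with
    | zero => simp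
    | succ k ih => rw [pow_succ', Module.End.mul_apply, ih, map_smul, ← hc, smul_smul, pow_succ]
  obtain ⟨k, hk⟩ := hf
  have hck : c = 0 := by
    have h0 := hpow k
    rw [hk, LinearMap.zero_apply] at h0
    exact eq_zero_of_pow_eq_zero ((smul_eq_zero.1 h0.symm).resolve_right hw0')
  ext x
  obtain ⟨t, ht⟩ := key x
  rw [Module.End.mul_apply, ← ht, map_smul, ← hc, hck]
  simp

/-- Linear maps of rank one with the same range and the same kernel are proportional. -/
lemma LinearMap.exists_eq_smul_of_range_eq_of_ker_eq
    {K V W : Type*} [Field K] [AddCommGroup V] [Module K V] [AddCommGroup W] [Module K W]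
    {f g : V →ₗ[K] W} (h : Module.finrank K (LinearMap.range g) = 1)
    (hr : LinearMap.range f = LinearMap.range g) (hk : LinearMap.ker f = LinearMap.ker g) :
    ∃ c : K, c ≠ 0 ∧ f = c • g := by
  obtain ⟨⟨w, x₀, hx₀⟩, hw0, hspan⟩ := finrank_eq_one_iff'.1 h
  have key : ∀ y ∈ LinearMap.range g, ∃ t : K, t • w = y := fun y hy => by
    obtain ⟨t, ht⟩ := hspan ⟨y, hy⟩
    exact ⟨t, congrArg Subtype.val ht⟩
  obtain ⟨c, hc⟩ := key (f x₀) (hr ▸ LinearMap.mem_range_self f x₀)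
  have hfg : f = c • g := by
    ext x
    obtain ⟨t, ht⟩ := key (g x) (LinearMap.mem_range_self g x)
    have hmem : x - t • x₀ ∈ LinearMap.ker f := by
      rw [hk, LinearMap.mem_ker, map_sub, map_smul, hx₀, ht, sub_self]
    rw [LinearMap.mem_ker, map_sub, map_smul, sub_eq_zero] at hmem
    rw [hmem, LinearMap.smul_apply, ← ht, ← hc, smul_comm]
  refine ⟨c, ?_, hfg⟩
  rintro rfl
  rw [hfg, zero_smul, LinearMap.range_zero] at hr
  rw [← hr, finrank_bot] at h
  exact zero_ne_one h

lemma linQ_one {n : ℕ} : linQ (1 : SLZ n) = 0 := by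
  ext
  simp [linQ, matQ]

lemma linQ_mul {n : ℕ} (g h : SLZ n) : linQ (g * h) = linQ g + linQ h + linQ g * linQ h := by
  have hm : matQ (g * h) = matQ g * matQ h := by simp [matQ]
  rw [linQ, linQ, linQ, hm, Module.End.mul_eq_comp, ← Matrix.mulVecLin_mul,
    ← Matrix.mulVecLin_add, ← Matrix.mulVecLin_add]
  congr 1
  noncomm_ring

lemma linQ_injective {n : ℕ} : Function.Injective (linQ (n := n)) := fun g h hgh => by
  have hm : matQ g = matQ h := sub_left_injective (Matrix.mulVec_injective
    (funext fun x => LinearMap.congr_fun hgh x))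
  ext i j
  simpa [matQ] using congrFun (congrFun hm i) j

lemma linQ_pow {n : ℕ} {g : SLZ n} (hg : linQ g * linQ g = 0) (k : ℕ) :
    linQ (g ^ k) = (k : ℚ) • linQ g := by
  induction k with
  | zero => simp [linQ_one]
  | succ k ih =>
    rw [pow_succ, linQ_mul, ih, smul_mul_assoc, hg, smul_zero, add_zero, Nat.cast_succ,
      add_smul, one_smul]

lemma linQ_inv {n : ℕ} {g : SLZ n} (hg : linQ g * linQ g = 0) : linQ g⁻¹ = -linQ g := by
  have h := linQ_mul g g⁻¹
  rw [mul_inv_cancel, linQ_one] at h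
  have hmul : linQ g * linQ g⁻¹ = 0 := by
    have h' := congrArg (linQ g * ·) h
    simpa [mul_add, ← mul_assoc, hg] using h'.symm
  rw [hmul, add_zero] at h
  exact (neg_eq_of_add_eq_zero_right h.symm).symm

lemma linQ_zpow {n : ℕ} {g : SLZ n} (hg : linQ g * linQ g = 0) (k : ℤ) :
    linQ (g ^ k) = (k : ℚ) • linQ g := by
  obtain ⟨m, rfl | rfl⟩ := k.eq_nat_or_neg
  · simpa using linQ_pow hg m
  · have hinv : linQ g⁻¹ * linQ g⁻¹ = 0 := by
      rw [linQ_inv hg]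
      exact (neg_mul_neg (α := Module.End ℚ (Fin n → ℚ)) _ _).trans hg
    rw [_root_.zpow_neg, _root_.zpow_natCast, ← inv_pow, linQ_pow hinv, linQ_inv hg, smul_neg,
      Int.cast_neg, Int.cast_natCast]
    exact (neg_smul _ _).symm

/-- Half of Lemma 2.2: two rank-1 unipotents `u, v ∈ SL(n,ℤ)` satisfy
`u^s = v^r` for some nonzero integers `r, s` iff they have the same image line
and the same kernel hyperplane in `ℚⁿ`. -/
theorem rank_one_unipotent_commensurable_iff (n : ℕ) (hn : 3 ≤ n)
    (u v : SLZ n) (hu : IsR1U u) (hv : IsR1U v) :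
    (∃ r s : ℤ, r ≠ 0 ∧ s ≠ 0 ∧ u ^ s = v ^ r) ↔
      (LinearMap.range (linQ u) = LinearMap.range (linQ v) ∧
        LinearMap.ker (linQ u) = LinearMap.ker (linQ v)) := by
  have hu2 := Module.End.mul_self_eq_zero_of_isNilpotent_of_finrank_range_eq_one hu.1 hu.2
  have hv2 := Module.End.mul_self_eq_zero_of_isNilpotent_of_finrank_range_eq_one hv.1 hv.2
  constructor
  · rintro ⟨r, s, hr, hs, h⟩
    have hl := congrArg linQ h
    rw [linQ_zpow hu2, linQ_zpow hv2] at hl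
    have hr' : (r : ℚ) ≠ 0 := Int.cast_ne_zero.2 hr
    have hs' : (s : ℚ) ≠ 0 := Int.cast_ne_zero.2 hs
    rw [← LinearMap.range_smul (linQ u) _ hs', ← LinearMap.ker_smul (linQ u) _ hs', hl,
      LinearMap.range_smul _ _ hr', LinearMap.ker_smul _ _ hr']
    exact ⟨rfl, rfl⟩
  · rintro ⟨hr, hk⟩
    obtain ⟨c, hc, h⟩ := LinearMap.exists_eq_smul_of_range_eq_of_ker_eq hv.2 hr hk
    refine ⟨c.num, c.den, Rat.num_ne_zero.2 hc, Int.natCast_ne_zero.2 c.den_ne_zero,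
      linQ_injective ?_⟩
    rw [linQ_zpow hu2, linQ_zpow hv2, h, smul_smul, Int.cast_natCast, Rat.den_mul_eq_num]
end

section
/- Let n ≥ 3 and let u ∈ SL(n,ℤ) be a rank-1 unipotent element. For every ε > 0 and every δ > 0 there exists a constant c such that if m ≥ c and v = u^m, then v^k • x ∈ (p_u)_ε for every x ∈ ℙ ∖ (L_u)_δ and every integer k ≠ 0; moreover p_v = p_u and L_v = L_u. -/
/- Common setup: `SL(n,ℤ)`, `SL(n,ℝ)`, the real projective space `ℙ^{n-1}(ℝ)`
with its quotient topology and the projective action, rank-1 unipotent elements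
and their attracting points / fixed hyperplanes, metrics compatible with the
topology of `ℙ`, `ε`-neighbourhoods, Schottky systems, profinite density,
maximal subgroups, and lattices in `SL(n,ℝ)`. -/

open Matrix LinearAlgebra.Projectivization

/-- A nilpotent matrix of rank one is an outer product `w φᵀ` with `φ ⬝ᵥ w = 0`. -/
theorem exists_eq_vecMulVec_of_isNilpotent {K : Type*} [Field K] {n : ℕ}
    (A : Matrix (Fin n) (Fin n) K) (hnil : IsNilpotent A.mulVecLin)
    (hrank : Module.finrank K (LinearMap.range A.mulVecLin) = 1) :
    ∃ w φ : Fin n → K, w ≠ 0 ∧ φ ≠ 0 ∧ φ ⬝ᵥ w = 0 ∧ A = vecMulVec w φ := by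
  obtain ⟨⟨w, hw⟩, hw0, hspan⟩ := finrank_eq_one_iff'.1 hrank
  have hw0' : w ≠ 0 := fun h => hw0 (Subtype.ext h)
  have hcol : ∀ j, ∃ c : K, c • w = A *ᵥ Pi.single j 1 := fun j => by
    obtain ⟨c, hc⟩ := hspan ⟨A *ᵥ Pi.single j 1, Pi.single j 1, rfl⟩
    exact ⟨c, congrArg Subtype.val hc⟩
  choose φ hφ using hcol
  have hA : A = vecMulVec w φ := by
    ext i j
    have := congrFun (hφ j) i
    simp only [Pi.smul_apply, smul_eq_mul, mulVec_single_one, col_apply] at this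
    rw [vecMulVec_apply, ← this, mul_comm]
  have happly : ∀ x, A *ᵥ x = (φ ⬝ᵥ x) • w := fun x => by
    rw [hA, vecMulVec_mulVec]
    simp
  refine ⟨w, φ, hw0', ?_, ?_, hA⟩
  · rintro rfl
    obtain ⟨x, hx⟩ := hw
    apply hw0'
    rw [← hx, mulVecLin_apply, happly, zero_dotProduct, zero_smul]
  · obtain ⟨k, hk⟩ := hnil
    have hpow : ∀ k : ℕ, (A.mulVecLin ^ k) w = (φ ⬝ᵥ w) ^ k • w := by
      intro k
      induction k with
      | zero => simp
      | succ k ih =>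
        rw [pow_succ', Module.End.mul_apply, ih, map_smul, mulVecLin_apply, happly, smul_smul,
          pow_succ]
    have h := hpow k
    rw [hk, LinearMap.zero_apply] at h
    exact eq_zero_of_pow_eq_zero ((smul_eq_zero.1 h.symm).resolve_right hw0')

theorem IsR1U.exists_vecMulVec {n : ℕ} {u : SLZ n} (hu : IsR1U u) :
    ∃ w φ : Fin n → ℝ, w ≠ 0 ∧ φ ≠ 0 ∧ φ ⬝ᵥ w = 0 ∧ matR u = 1 + vecMulVec w φ := by
  obtain ⟨w, φ, hw, hφ, hφw, hA⟩ := exists_eq_vecMulVec_of_isNilpotent (matQ u - 1) hu.1 hu.2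
  refine ⟨fun i => w i, fun i => φ i, fun h => hw ?_, fun h => hφ ?_, ?_, ?_⟩
  · ext i
    exact Rat.cast_eq_zero.1 (congrFun h i)
  · ext i
    exact Rat.cast_eq_zero.1 (congrFun h i)
  · simp only [dotProduct] at hφw ⊢
    exact_mod_cast congrArg (Rat.cast : ℚ → ℝ) hφw
  · ext i j
    have h : matQ u i j = (1 : Matrix (Fin n) (Fin n) ℚ) i j + w i * φ j := by
      rw [← vecMulVec_apply, ← hA, Matrix.sub_apply]
      ring
    have hQ : matQ u i j = ((u.1 i j : ℤ) : ℚ) := rfl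
    have hR : matR u i j = ((u.1 i j : ℤ) : ℝ) := rfl
    rw [hQ] at h
    have h' := congrArg (Rat.cast : ℚ → ℝ) h
    rw [hR, Matrix.add_apply, vecMulVec_apply]
    rw [Matrix.one_apply] at h' ⊢
    split_ifs at h' ⊢ <;> simpa using h'

theorem matR_mul {n : ℕ} (g h : SLZ n) : matR (g * h) = matR g * matR h := by
  simp only [matR, map_mul, Matrix.SpecialLinearGroup.coe_mul]

theorem matR_one {n : ℕ} : matR (1 : SLZ n) = 1 := by
  simp only [matR, map_one, Matrix.SpecialLinearGroup.coe_one]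

theorem matR_zpow_of_sq_zero {n : ℕ} {u : SLZ n} {N : Matrix (Fin n) (Fin n) ℝ}
    (hN : N * N = 0) (hu : matR u = 1 + N) (k : ℤ) : matR (u ^ k) = 1 + (k : ℝ) • N := by
  have hinv : matR u⁻¹ = 1 - N := by
    have h1 : matR u⁻¹ * matR u = 1 := by rw [← matR_mul, inv_mul_cancel, matR_one]
    have h2 : matR u * (1 - N) = 1 := by
      rw [hu, add_mul, mul_sub, mul_sub, hN]
      simp
    exact left_inv_eq_right_inv h1 h2
  induction k with
  | zero => simp [matR_one]
  | succ k ih =>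
    rw [_root_.zpow_add_one, matR_mul, ih, hu, mul_add, mul_one, add_mul, one_mul, smul_mul_assoc, hN]
    push_cast
    module
  | pred k ih =>
    rw [_root_.zpow_sub_one, matR_mul, ih, hinv, mul_sub, mul_one, add_mul, one_mul, smul_mul_assoc, hN]
    push_cast
    module

theorem act_mk {n : ℕ} (g : SLZ n) (v : Fin n → ℝ) (hv : v ≠ 0) :
    ∃ h : matR g *ᵥ v ≠ 0, act g (Projectivization.mk ℝ v hv) =
      Projectivization.mk ℝ (matR g *ᵥ v) h :=
  ⟨fun h => hv ((Matrix.SpecialLinearGroup.toLin'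
    (Matrix.SpecialLinearGroup.map (Int.castRingHom ℝ) g)).injective (h.trans (map_zero _).symm)),
    rfl⟩

theorem isOpen_setOf_mk_mem {n : ℕ} {U : Set (Proj n)} (hU : IsOpen U) :
    IsOpen {v : Fin n → ℝ | ∃ h : v ≠ 0, Projectivization.mk ℝ v h ∈ U} := by
  have hcont : Continuous (fun v : {v : Fin n → ℝ // v ≠ 0} => Projectivization.mk ℝ v.1 v.2) :=
    continuous_quot_mk
  have h := (isOpen_compl_singleton (x := (0 : Fin n → ℝ))).isOpenMap_subtype_val _
    (hU.preimage hcont)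
  convert h using 1
  ext v
  constructor
  · rintro ⟨h0, h1⟩
    exact ⟨⟨v, h0⟩, h1, rfl⟩
  · rintro ⟨⟨v, h0⟩, h1, rfl⟩
    exact ⟨h0, h1⟩

theorem exists_norm_one_rep {n : ℕ} (x : Proj n) :
    ∃ v : Fin n → ℝ, ‖v‖ = 1 ∧ ∃ h : v ≠ 0, x = Projectivization.mk ℝ v h := by
  induction x using Projectivization.ind with
  | h v hv =>
    have hne : ‖v‖⁻¹ ≠ 0 := inv_ne_zero (norm_ne_zero_iff.2 hv)
    refine ⟨‖v‖⁻¹ • v, norm_smul_inv_norm hv, smul_ne_zero hne hv, ?_⟩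
    exact ((Projectivization.mk_eq_mk_iff' ℝ _ _ _ _).2 ⟨‖v‖⁻¹, rfl⟩).symm

namespace IsCompatMetric

variable {n : ℕ} {d : Proj n → Proj n → ℝ}

theorem nonneg (hd : IsCompatMetric d) (x y : Proj n) : 0 ≤ d x y := by
  have h := hd.triangle x y x
  rw [hd.self, hd.symm y x] at h
  linarith

theorem setDist_le (hd : IsCompatMetric d) (x : Proj n) {A : Set (Proj n)} {a : Proj n}
    (ha : a ∈ A) : setDist d x A ≤ d x a :=
  csInf_le ⟨0, by rintro _ ⟨y, -, rfl⟩; exact hd.nonneg x y⟩ ⟨a, ha, rfl⟩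

theorem isOpen_ball (hd : IsCompatMetric d) (p : Proj n) (r : ℝ) : IsOpen {y | d y p < r} := by
  rw [hd.inducing]
  intro x hx
  refine ⟨r - d x p, sub_pos.2 hx, fun y hy => ?_⟩
  have h := hd.triangle y x p
  rw [hd.symm y x] at h
  show d y p < r
  linarith

theorem oThick_eq_iUnion (hd : IsCompatMetric d) {A : Set (Proj n)} (hA : A.Nonempty) (r : ℝ) :
    oThick d A r = ⋃ a ∈ A, {y | d y a < r} := by
  ext x
  simp only [Set.mem_iUnion, Set.mem_ofPred_eq, exists_prop]
  constructor
  · intro (hx : sInf (d x '' A) < r)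
    obtain ⟨_, ⟨a, ha, rfl⟩, h⟩ := exists_lt_of_csInf_lt (hA.image _) hx
    exact ⟨a, ha, h⟩
  · rintro ⟨a, ha, h⟩
    exact (hd.setDist_le x ha).trans_lt h

theorem isOpen_oThick (hd : IsCompatMetric d) {A : Set (Proj n)} (hA : A.Nonempty) (r : ℝ) :
    IsOpen (oThick d A r) := by
  rw [hd.oThick_eq_iUnion hA]
  exact isOpen_biUnion fun a _ => hd.isOpen_ball a r

end IsCompatMetric

/-- On a compact set of vectors off the hyperplane `φ = 0`, the directions
`(φ ⬝ᵥ v) w + s v` tend uniformly to that of `w` as `s → 0`. -/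
theorem eventually_forall_mk_mem {n : ℕ} {w φ : Fin n → ℝ} (hw : w ≠ 0) {C : Set (Fin n → ℝ)}
    (hC : IsCompact C) (hφ : ∀ v ∈ C, φ ⬝ᵥ v ≠ 0) {U : Set (Proj n)} (hU : IsOpen U)
    (hwU : Projectivization.mk ℝ w hw ∈ U) :
    ∀ᶠ s : ℝ in nhds 0, ∀ v ∈ C,
      ∃ h : (φ ⬝ᵥ v) • w + s • v ≠ 0, Projectivization.mk ℝ _ h ∈ U := by
  refine hC.eventually_forall_of_forall_eventually fun v hv => ?_
  have hcont : Continuous fun z : ℝ × (Fin n → ℝ) => (φ ⬝ᵥ z.2) • w + z.1 • z.2 := by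
    simp only [dotProduct]
    fun_prop
  refine hcont.continuousAt.eventually_mem ((isOpen_setOf_mk_mem hU).mem_nhds ?_)
  have h0 : (φ ⬝ᵥ v) • w + (0 : ℝ) • v = (φ ⬝ᵥ v) • w := by simp
  refine ⟨by rw [h0]; exact smul_ne_zero (hφ v hv) hw, ?_⟩
  convert hwU using 1
  exact (Projectivization.mk_eq_mk_iff' ℝ _ _ _ _).2 ⟨φ ⬝ᵥ v, h0.symm⟩

/-- Lemma 2.3 (dynamics of unipotent elements): for a rank-1 unipotent `u` and
`ε, δ > 0` there is `c` such that for all `m ≥ c` and `v = u^m`, every nonzero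
power `v^k` maps `ℙ ∖ (L_u)_δ` into `(p_u)_ε`; moreover `p_v = p_u`, `L_v = L_u`. -/
theorem unipotent_dynamics (n : ℕ) (hn : 3 ≤ n) (d : Proj n → Proj n → ℝ)
    (hd : IsCompatMetric d) (u : SLZ n) (hu : IsR1U u)
    (ε δ : ℝ) (hε : 0 < ε) (hδ : 0 < δ) :
    ∃ c : ℕ, ∀ m : ℕ, c ≤ m →
      (∀ k : ℤ, k ≠ 0 → ∀ x : Proj n, x ∉ oThick d (fixSet u) δ →
          act ((u ^ m) ^ k) x ∈ oThick d (attSet u) ε) ∧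
      lineOf (u ^ m) = lineOf u ∧ hypOf (u ^ m) = hypOf u := by
  obtain ⟨w, φ, hw, hφ, hφw, hu'⟩ := hu.exists_vecMulVec
  set N := vecMulVec w φ with hNdef
  have hN : N * N = 0 := by
    rw [hNdef, vecMulVec_mul_vecMulVec, hφw, zero_smul, vecMulVec_zero]
  have happ : ∀ x, N *ᵥ x = (φ ⬝ᵥ x) • w := fun x => by
    rw [hNdef, vecMulVec_mulVec]
    simp
  have hsub : matR u - 1 = N := by rw [hu', add_sub_cancel_left]
  set p := Projectivization.mk ℝ w hw
  have hpatt : p ∈ attSet u := by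
    show p.submodule = lineOf u
    rw [Projectivization.submodule_mk, lineOf, hsub]
    apply le_antisymm
    · obtain ⟨i, hi⟩ := Function.ne_iff.1 hφ
      rw [Submodule.span_singleton_le_iff_mem]
      refine ⟨Pi.single i (φ i)⁻¹, ?_⟩
      rw [mulVecLin_apply, happ, dotProduct_single, mul_inv_cancel₀ hi, one_smul]
    · rintro _ ⟨x, rfl⟩
      rw [mulVecLin_apply, happ]
      exact Submodule.smul_mem _ _ (Submodule.mem_span_singleton_self w)
  have hfix : ∀ v (hv : v ≠ 0), φ ⬝ᵥ v = 0 → Projectivization.mk ℝ v hv ∈ fixSet u := by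
    intro v hv h
    show Projectivization.submodule _ ≤ hypOf u
    rw [Projectivization.submodule_mk, Submodule.span_singleton_le_iff_mem, hypOf, hsub,
      LinearMap.mem_ker, mulVecLin_apply, happ, h, zero_smul]
  have hopen : IsOpen (oThick d (fixSet u) δ) := hd.isOpen_oThick ⟨p, hfix w hw hφw⟩ δ
  have hC := (isCompact_sphere (0 : Fin n → ℝ) 1).diff (isOpen_setOf_mk_mem hopen)
  have hev := eventually_forall_mk_mem (φ := φ) hw hC (fun v hv h0 => by
    have hv0 : v ≠ 0 := by
      rintro rfl
      simpa using hv.1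
    refine hv.2 ⟨hv0, (hd.setDist_le _ (hfix v hv0 h0)).trans_lt ?_⟩
    rwa [hd.self]) (hd.isOpen_ball p ε) (show d p p < ε by rwa [hd.self])
  obtain ⟨η, hη, hball⟩ := Metric.eventually_nhds_iff.1 hev
  obtain ⟨c, hc⟩ := exists_nat_gt η⁻¹
  have hc0 : (0 : ℝ) < c := (inv_pos.2 hη).trans hc
  refine ⟨c, fun m hm => ?_⟩
  have hmc : (c : ℝ) ≤ m := by exact_mod_cast hm
  have hm0 : (m : ℝ) ≠ 0 := (hc0.trans_le hmc).ne'
  have hsubm : matR (u ^ m) - 1 = (m : ℝ) • N := by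
    have h := matR_zpow_of_sq_zero hN hu' m
    rw [zpow_natCast] at h
    rw [h, add_sub_cancel_left, Int.cast_natCast]
  have hlin : (matR (u ^ m) - 1).mulVecLin = (m : ℝ) • (matR u - 1).mulVecLin := by
    ext1 i
    ext1
    simp [hsubm, hsub]
  refine ⟨fun k hk x hx => ?_, ?_, ?_⟩
  · obtain ⟨v, hv1, hv, rfl⟩ := exists_norm_one_rep x
    have hk1 : (1 : ℝ) ≤ |(k : ℝ)| := by exact_mod_cast Int.one_le_abs hk
    have ht : (c : ℝ) ≤ |(m : ℝ) * k| := by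
      rw [abs_mul, Nat.abs_cast]
      nlinarith
    have ht0 : (m : ℝ) * k ≠ 0 := abs_pos.1 (hc0.trans_le ht)
    obtain ⟨h1, h2⟩ := hball (y := ((m : ℝ) * k)⁻¹) (by
      rw [Real.dist_0_eq_abs, abs_inv]
      exact inv_lt_of_inv_lt₀ hη (hc.trans_le ht)) v ⟨by simpa using hv1, fun h => hx h.2⟩
    obtain ⟨h3, h4⟩ := act_mk ((u ^ m) ^ k) v hv
    have hpow : matR ((u ^ m) ^ k) = 1 + ((m : ℝ) * k) • N := by
      rw [← zpow_natCast u m, ← _root_.zpow_mul, matR_zpow_of_sq_zero hN hu']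
      push_cast
      rfl
    have heq : act ((u ^ m) ^ k) (Projectivization.mk ℝ v hv) = Projectivization.mk ℝ _ h1 := by
      rw [h4, Projectivization.mk_eq_mk_iff']
      refine ⟨(m : ℝ) * k, ?_⟩
      rw [hpow, add_mulVec, one_mulVec, smul_mulVec, happ, smul_add, smul_smul _ _⁻¹ v,
        mul_inv_cancel₀ ht0, one_smul, add_comm]
    rw [heq]
    exact (hd.setDist_le _ hpatt).trans_lt h2
  · rw [lineOf, hlin, LinearMap.range_smul _ _ hm0, lineOf]
  · rw [hypOf, hlin, LinearMap.ker_smul _ _ hm0, hypOf]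
end
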